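/- Let R be a Noetherian ring and I an ideal of R. If M is a finitely generated R-module such that dim M/IM ≤ 1, then the R-modules H^i_I(M) are I-cofinite for all i ≥ 0. -/

import Mathlib

universe u

open CategoryTheory

/-- An `R`-module `L` is `I`-cofinite if `Supp L ⊆ V(I)` and `Ext^i_R(R/I, L)` is a finitely
generated `R`-module for all `i ≥ 0`. -/
def IsCofinite {R : Type u} [CommRing R] (I : Ideal R) (L : ModuleCat.{u} R) : Prop :=
  Module.support R L ⊆ PrimeSpectrum.zeroLocus (I : Set R) ∧
    ∀ i : ℕ, Module.Finite R
      (((Ext R (ModuleCat.{u} R) i).obj (Opposite.op (ModuleCat.of R (R ⧸ I)))).obj L)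

namespace LCCof

open Opposite


variable {R : Type u} [CommRing R]

section compare
variable {X : ModuleCat.{u} R} (P : ProjectiveResolution X) (N : ModuleCat.{u} R)

open Abelian in
lemma extMk_eq_zero_zero (f : P.complex.X 0 ⟶ N) (m : ℕ) (hm : 0 + 1 = m)
    (hf : P.complex.d m 0 ≫ f = 0) (h : P.extMk f m hm hf = 0) : f = 0 := by
  simp only [← P.extEquivCohomologyClass.apply_eq_iff_eq,
    ProjectiveResolution.extEquivCohomologyClass_extMk, 
    ProjectiveResolution.extEquivCohomologyClass_zero,
    CochainComplex.HomComplex.CohomologyClass.mk_eq_zero_iff] at h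
  rw [CochainComplex.HomComplex.Cocycle.toSingleMk_mem_coboundaries_iff _ _ _ _ _ (1) (by lia)] at h
  obtain ⟨g, hg⟩ := h
  have : g = 0 := by
    apply Limits.IsZero.eq_of_src
    exact CochainComplex.isZero_of_isStrictlyLE _ 0 _ (by lia)
  subst this
  rw [← cancel_epi (P.cochainComplexXIso (-(0:ℕ)) 0 rfl).hom]
  simpa using hg.symm



lemma linYon_d_apply (i j : ℕ) (f : P.complex.X i ⟶ N) :
    ((P.complex.linearYonedaObj R N).d i j).hom f = P.complex.d j i ≫ f := rfl

/-- underlying map of a cycle. -/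
noncomputable def iC (n : ℕ) :
    (P.complex.linearYonedaObj R N).cycles n →ₗ[R] (P.complex.X n ⟶ N) :=
  ((P.complex.linearYonedaObj R N).iCycles n).hom

lemma iCycles_cocycle (n : ℕ) (c : (P.complex.linearYonedaObj R N).cycles n) :
    P.complex.d (n+1) n ≫ iC P N n c = 0 := by
  have := (P.complex.linearYonedaObj R N).iCycles_d n (n+1)
  exact congrArg (fun g => g.hom c) this

lemma smul_extMk (n : ℕ) (r : R) (f : P.complex.X n ⟶ N) (hf : P.complex.d (n+1) n ≫ f = 0) :
    P.extMk (r • f) (n+1) rfl (by simp [hf]) = r • P.extMk f (n+1) rfl hf := by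
  rw [Abelian.Ext.smul_eq_comp_mk₀, ProjectiveResolution.extMk_comp_mk₀]
  simp

/-- cycles to `Ext`. -/
noncomputable def cyclesToExt (n : ℕ) :
    (P.complex.linearYonedaObj R N).cycles n →ₗ[R] Abelian.Ext X N n where
  toFun c := P.extMk (iC P N n c) (n+1) rfl (iCycles_cocycle P N n c)
  map_add' c c' := by
    rw [ProjectiveResolution.add_extMk]
    simp only [map_add]
  map_smul' r c := by
    rw [RingHom.id_apply, ← smul_extMk]
    simp only [map_smul]

lemma exists_cycle (n : ℕ) (f : P.complex.X n ⟶ N) (hf : P.complex.d (n+1) n ≫ f = 0) :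
    ∃ c, iC P N n c = f := by
  let K := P.complex.linearYonedaObj R N
  let k : ModuleCat.of R R ⟶ K.X n := ModuleCat.ofHom (LinearMap.toSpanSingleton R (K.X n) f)
  have hk : k ≫ K.d n (n+1) = 0 := by
    apply ModuleCat.hom_ext
    apply LinearMap.ext_ring
    change P.complex.d (n+1) n ≫ ((1:R) • f) = 0
    simp [hf]
  refine ⟨(K.liftCycles k (n+1) (by simp) hk).hom (1:R), ?_⟩
  have := K.liftCycles_i k (n+1) (by simp) hk
  have h2 := congrArg (fun g => g.hom (1:R)) this
  refine h2.trans ?_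
  change (1:R) • f = f
  simp

lemma cyclesToExt_surjective (n : ℕ) : Function.Surjective (cyclesToExt P N n) := by
  intro x
  obtain ⟨f, hf, rfl⟩ := P.extMk_surjective x (n+1) rfl
  obtain ⟨c, hc⟩ := exists_cycle P N n f hf
  refine ⟨c, ?_⟩
  simp only [cyclesToExt, LinearMap.coe_mk, AddHom.coe_mk, hc]

lemma homologyπ_eq_zero_iff (K : CochainComplex (ModuleCat.{u} R) ℕ) (n : ℕ) (c : K.cycles n) :
    (K.homologyπ n).hom c = 0 ↔ 
      ∃ b, (K.d ((ComplexShape.up ℕ).prev n) n).hom b = (K.iCycles n).hom c := by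
  constructor
  · intro h
    have hex : (ShortComplex.mk (K.toCycles ((ComplexShape.up ℕ).prev n) n) (K.homologyπ n) 
        (by simp)).Exact :=
      ShortComplex.exact_of_g_is_cokernel _ (K.homologyIsCokernel _ n rfl)
    rw [ShortComplex.moduleCat_exact_iff] at hex
    obtain ⟨b, hb⟩ := hex c h
    refine ⟨b, ?_⟩
    have := K.toCycles_i ((ComplexShape.up ℕ).prev n) n
    rw [← this]
    change _ = (K.iCycles n).hom c
    rw [← hb]; rfl
  · rintro ⟨b, hb⟩
    have : (K.toCycles ((ComplexShape.up ℕ).prev n) n).hom b = c := by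
      have hmono : Function.Injective (K.iCycles n) := (ModuleCat.mono_iff_injective _).1 inferInstance
      apply hmono
      change _ = (K.iCycles n).hom c
      rw [← hb, ← K.toCycles_i ((ComplexShape.up ℕ).prev n) n]; rfl
    rw [← this]
    have := K.toCycles_comp_homologyπ ((ComplexShape.up ℕ).prev n) n
    exact congrArg (fun g => g.hom b) this

lemma cyclesToExt_eq_zero_iff (n : ℕ) (c) : cyclesToExt P N n c = 0 ↔ 
    ((P.complex.linearYonedaObj R N).homologyπ n).hom c = 0 := by
  rw [homologyπ_eq_zero_iff]
  simp only [cyclesToExt, LinearMap.coe_mk, AddHom.coe_mk]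
  cases n with
  | zero =>
    have hd : (P.complex.linearYonedaObj R N).d ((ComplexShape.up ℕ).prev 0) 0 = 0 := by
      apply HomologicalComplex.shape
      simp
    constructor
    · intro h
      have := extMk_eq_zero_zero _ _ _ _ _ _ h
      refine ⟨0, ?_⟩
      rw [map_zero]
      exact this.symm
    · rintro ⟨b, hb⟩
      have h0 : iC P N 0 c = 0 := by
        refine hb.symm.trans ?_
        rw [hd]; rfl
      simp [h0]
  | succ p =>
    rw [P.extMk_eq_zero_iff _ (p+1+1) rfl _ p rfl]
    have : (ComplexShape.up ℕ).prev (p+1) = p := by simp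
    rw [this]
    rfl

end compare


section compare2
open Abelian (Ext)
variable {X X' : ModuleCat.{u} R} (P : ProjectiveResolution X) (P' : ProjectiveResolution X')
   (N : ModuleCat.{u} R)

/-- functoriality of `linearYonedaObj` -/
noncomputable def linYonMap (φ : P'.complex ⟶ P.complex) : 
    P.complex.linearYonedaObj R N ⟶ P'.complex.linearYonedaObj R N :=
  (HomologicalComplex.unopFunctor _ _).map
    (((((linearYoneda R (ModuleCat.{u} R)).obj N).rightOp.mapHomologicalComplex _).map φ).op)

lemma homologyUnop_nat {K L : ChainComplex (ModuleCat.{u} R)ᵒᵖ ℕ} (φ : K ⟶ L) (n : ℕ) :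
    HomologicalComplex.homologyMap ((HomologicalComplex.unopFunctor _ _).map φ.op) n ≫ 
      (K.homologyUnop n).hom = (L.homologyUnop n).hom ≫ 
        (HomologicalComplex.homologyMap φ n).unop := by
  apply Quiver.Hom.op_inj
  have := HomologicalComplex.homologyOp_hom_naturality 
    ((HomologicalComplex.unopFunctor _ _).map φ.op) n
  exact this.symm

lemma sq_inv {C : Type*} [Category C] {A A' B B' : C} (a : A ≅ A') (b : B ≅ B') (h : A ⟶ B)
    (k : A' ⟶ B') (e : h ≫ b.hom = a.hom ≫ k) : k ≫ b.inv = a.inv ≫ h := by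
  rw [Iso.comp_inv_eq, Category.assoc, e, Iso.inv_hom_id_assoc]

lemma isoExt_nat (f : X' ⟶ X) (φ : ProjectiveResolution.Hom P' P f) (n : ℕ) :
    ((_root_.Ext R (ModuleCat.{u} R) n).map f.op).app N ≫ (P'.isoExt (R := R) n N).hom = 
      (P.isoExt (R := R) n N).hom ≫ HomologicalComplex.homologyMap (linYonMap P P' N φ.hom) n := by
  have h1 := ProjectiveResolution.isoLeftDerivedObj_inv_naturality f P' P φ.hom
    (by simpa using φ.hom_f_zero_comp_π_f_zero) ((linearYoneda R (ModuleCat.{u} R)).obj N).rightOp n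
  have h2 := homologyUnop_nat
    ((((linearYoneda R (ModuleCat.{u} R)).obj N).rightOp.mapHomologicalComplex _).map φ.hom) n
  replace h2 := sq_inv _ _ _ _ h2
  have h3 := congrArg Quiver.Hom.unop h1
  rw [unop_comp, unop_comp] at h3
  have h4 : ((_root_.Ext R (ModuleCat.{u} R) n).map f.op).app N ≫ 
      (P'.isoLeftDerivedObj ((linearYoneda R (ModuleCat.{u} R)).obj N).rightOp n).inv.unop = 
      (P.isoLeftDerivedObj ((linearYoneda R (ModuleCat.{u} R)).obj N).rightOp n).inv.unop ≫ 
      (HomologicalComplex.homologyMap ((((linearYoneda R (ModuleCat.{u} R)).obj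
        N).rightOp.mapHomologicalComplex _).map φ.hom) n).unop := h3
  have e1 : (P'.isoExt (R := R) n N).hom = 
    (P'.isoLeftDerivedObj ((linearYoneda R (ModuleCat.{u} R)).obj N).rightOp n).inv.unop ≫ 
      (HomologicalComplex.homologyUnop _ _).inv := rfl
  have e2 : (P.isoExt (R := R) n N).hom = 
    (P.isoLeftDerivedObj ((linearYoneda R (ModuleCat.{u} R)).obj N).rightOp n).inv.unop ≫ 
      (HomologicalComplex.homologyUnop _ _).inv := rfl
  rw [e1, e2]
  refine (Category.assoc _ _ _).symm.trans ?_
  refine (congrArg (fun z => z ≫ _) h4).trans ?_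
  refine (Category.assoc _ _ _).trans ?_
  refine Eq.trans ?_ (Category.assoc _ _ _).symm
  exact congrArg (fun z => _ ≫ z) h2

/-- cycles to the old `Ext`. -/
noncomputable def cyclesToOld (n : ℕ) : (P.complex.linearYonedaObj R N).cycles n →ₗ[R]
    ((_root_.Ext R (ModuleCat.{u} R) n).obj (op X)).obj N :=
  ((P.complex.linearYonedaObj R N).homologyπ n ≫ (P.isoExt (R := R) n N).inv).hom

lemma cyclesToOld_surjective (n : ℕ) : Function.Surjective (cyclesToOld P N n) := by
  have : Epi ((P.complex.linearYonedaObj R N).homologyπ n ≫ (P.isoExt (R := R) n N).inv) := 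
    inferInstance
  exact (ModuleCat.epi_iff_surjective _).1 this

lemma cyclesToOld_eq_zero_iff (n : ℕ) (c) : cyclesToOld P N n c = 0 ↔ 
    ((P.complex.linearYonedaObj R N).homologyπ n).hom c = 0 := by
  have hinj : Function.Injective (P.isoExt (R := R) n N).inv :=
    (ModuleCat.mono_iff_injective _).1 inferInstance
  constructor
  · intro h
    apply hinj
    rw [map_zero]
    exact h
  · intro h
    change (P.isoExt (R := R) n N).inv.hom (((P.complex.linearYonedaObj R N).homologyπ n).hom c) = 0
    rw [h, map_zero]

/-- the cycle-level pullback. -/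
noncomputable def cycPull (φ : P'.complex ⟶ P.complex) (n : ℕ) : 
    (P.complex.linearYonedaObj R N).cycles n →ₗ[R] (P'.complex.linearYonedaObj R N).cycles n :=
  (HomologicalComplex.cyclesMap (linYonMap P P' N φ) n).hom

lemma cyclesToOld_nat (f : X' ⟶ X) (φ : ProjectiveResolution.Hom P' P f) (n : ℕ) (c) : 
    (((_root_.Ext R (ModuleCat.{u} R) n).map f.op).app N).hom (cyclesToOld P N n c) = 
      cyclesToOld P' N n (cycPull P P' N φ.hom n c) := by
  have h := isoExt_nat P P' N f φ n
  rw [← Iso.eq_comp_inv, Category.assoc, ← Iso.inv_comp_eq] at h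
  have h2 := HomologicalComplex.homologyπ_naturality (linYonMap P P' N φ.hom) n
  have h3 : ((P.complex.linearYonedaObj R N).homologyπ n ≫ (P.isoExt (R := R) n N).inv) ≫ 
     (((_root_.Ext R (ModuleCat.{u} R) n).map f.op).app N) = 
     HomologicalComplex.cyclesMap (linYonMap P P' N φ.hom) n ≫
      (P'.complex.linearYonedaObj R N).homologyπ n ≫ (P'.isoExt (R := R) n N).inv := by
    rw [Category.assoc, h, reassoc_of% h2]
  exact congrArg (fun z => z.hom c) h3

lemma iC_cycPull (φ : P'.complex ⟶ P.complex) (n : ℕ) (c) :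
    iC P' N n (cycPull P P' N φ n c) = φ.f n ≫ iC P N n c := by
  have := HomologicalComplex.cyclesMap_i (linYonMap P P' N φ) n
  exact congrArg (fun z => z.hom c) this

lemma cyclesToExt_nat (f : X' ⟶ X) (φ : ProjectiveResolution.Hom P' P f) (n : ℕ) (c) : 
    (Ext.mk₀ f).comp (cyclesToExt P N n c) (zero_add n) = 
      cyclesToExt P' N n (cycPull P P' N φ.hom n c) := by
  simp only [cyclesToExt, LinearMap.coe_mk, AddHom.coe_mk]
  rw [ProjectiveResolution.mk₀_comp_extMk _ _ _ _ φ]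
  simp only [iC_cycPull]

lemma exists_resHom (f : X' ⟶ X) : Nonempty (ProjectiveResolution.Hom P' P f) := 
  ⟨⟨ProjectiveResolution.lift f P' P, by
    simpa using ProjectiveResolution.lift_commutes_zero f P' P⟩⟩

end compare2

section compare3
open Abelian (Ext)
variable (X N : ModuleCat.{u} R)

/-- Comparison of the two versions of `Ext`. -/
noncomputable def extCmp (n : ℕ) : 
    ((_root_.Ext R (ModuleCat.{u} R) n).obj (op X)).obj N ≃ₗ[R] Ext X N n :=
  ((cyclesToOld (projectiveResolution X) N n).quotKerEquivOfSurjective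
    (cyclesToOld_surjective _ _ _)).symm ≪≫ₗ 
  (Submodule.quotEquivOfEq _ _ (by
    ext c
    rw [LinearMap.mem_ker, LinearMap.mem_ker, cyclesToOld_eq_zero_iff, cyclesToExt_eq_zero_iff])) 
  ≪≫ₗ
  ((cyclesToExt (projectiveResolution X) N n).quotKerEquivOfSurjective
    (cyclesToExt_surjective _ _ _))

lemma extCmp_cyc (n : ℕ) (c) : extCmp X N n (cyclesToOld (projectiveResolution X) N n c) = 
    cyclesToExt (projectiveResolution X) N n c := by
  have : ((cyclesToOld (projectiveResolution X) N n).quotKerEquivOfSurjective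
    (cyclesToOld_surjective _ _ _)).symm (cyclesToOld (projectiveResolution X) N n c) = 
      Submodule.Quotient.mk c := by
    rw [LinearEquiv.symm_apply_eq]; rfl
  simp only [extCmp, LinearEquiv.trans_apply, this]
  rfl

lemma extCmp_nat {X X' : ModuleCat.{u} R} (f : X' ⟶ X) (n : ℕ)
    (x : ((_root_.Ext R (ModuleCat.{u} R) n).obj (op X)).obj N) :
    extCmp X' N n ((((_root_.Ext R (ModuleCat.{u} R) n).map f.op).app N).hom x) =
      (Ext.mk₀ f).comp (extCmp X N n x) (zero_add n) := by
  obtain ⟨c, rfl⟩ := cyclesToOld_surjective (projectiveResolution X) N n x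
  obtain ⟨φ⟩ := exists_resHom (projectiveResolution X) (projectiveResolution X') f
  rw [extCmp_cyc, cyclesToExt_nat _ _ _ _ φ, cyclesToOld_nat _ _ _ _ φ, extCmp_cyc]

end compare3


section lc
open Abelian (Ext)
variable (I : Ideal R)

/-- `R/I^n`. -/
abbrev Qn (n : ℕ) : ModuleCat.{u} R := ModuleCat.of R (R ⧸ I ^ n)

/-- transition map. -/
def tr {m n : ℕ} (h : m ≤ n) : Qn I n ⟶ Qn I m :=
  ModuleCat.ofHom (Submodule.mapQ _ _ LinearMap.id (Ideal.pow_le_pow_right h))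

/-- restriction -/
noncomputable def rs {m n : ℕ} (h : m ≤ n) (N : ModuleCat.{u} R) (i : ℕ) :
    Ext (Qn I m) N i →ₗ[R] Ext (Qn I n) N i :=
  (Ext.mk₀ (tr I h)).precompOfLinear R N (zero_add i)

lemma rs_apply {m n : ℕ} (h : m ≤ n) (N : ModuleCat.{u} R) (i : ℕ) (x : Ext (Qn I m) N i) :
   rs I h N i x = (Ext.mk₀ (tr I h)).comp x (zero_add i) := rfl

lemma tr_comp {m n k : ℕ} (h : m ≤ n) (h' : n ≤ k) : tr I h' ≫ tr I h = tr I (h.trans h') := by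
  apply ModuleCat.hom_ext
  apply LinearMap.ext
  rintro ⟨x⟩
  rfl

lemma rs_rs {m n k : ℕ} (h : m ≤ n) (h' : n ≤ k) (N : ModuleCat.{u} R) (i : ℕ)
    (x : Ext (Qn I m) N i) : rs I h' N i (rs I h N i x) = rs I (h.trans h') N i x := by
  simp only [rs_apply]
  rw [← tr_comp I h h', ← Ext.mk₀_comp_mk₀_assoc]

lemma rs_post {m n : ℕ} (h : m ≤ n) {N N' : ModuleCat.{u} R} {i j k : ℕ}
    (x : Ext (Qn I m) N i) (b : Ext N N' j) (e : i + j = k) : 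
    rs I h N' k (x.comp b e) = (rs I h N i x).comp b e := by
  simp only [rs_apply]
  rw [Ext.comp_assoc _ _ _ _ _ (by lia)]

/-- `L` is the colimit of `Ext^i(R/I^n, N)`. -/
structure IsLC (i : ℕ) (N : ModuleCat.{u} R) (L : Type u) [AddCommGroup L] [Module R L]
    (ι : ∀ n, Ext (Qn I n) N i →ₗ[R] L) : Prop where
  compat : ∀ {m n : ℕ} (h : m ≤ n) x, ι n (rs I h N i x) = ι m x
  surj : ∀ y, ∃ n x, ι n x = y
  inj : ∀ n x, ι n x = 0 → ∃ m, ∃ h : n ≤ m, rs I h N i x = 0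

/-- uniqueness of colimits -/
lemma IsLC.nonempty_equiv {i : ℕ} {N : ModuleCat.{u} R} {L L' : Type u} [AddCommGroup L] [Module R L]
    [AddCommGroup L'] [Module R L'] {ι ι'} (h : IsLC I i N L ι) (h' : IsLC I i N L' ι') : 
    Nonempty (L ≃ₗ[R] L') := by
  have key : ∀ (L L' : Type u) [AddCommGroup L] [Module R L]
    [AddCommGroup L'] [Module R L'] (ι ι') (h : IsLC I i N L ι) (h' : IsLC I i N L' ι'),
    ∃ f : L →ₗ[R] L', ∀ n x, f (ι n x) = ι' n x := by
    intro L L' _ _ _ _ ι ι' h h'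
    have hw : ∀ m n x x', ι m x = ι n x' → ι' m x = ι' n x' := by
      intro m n x x' e
      have hm := le_max_left m n
      have hn := le_max_right m n
      have : ι (max m n) (rs I hm N i x - rs I hn N i x') = 0 := by
        rw [map_sub, h.compat, h.compat, e, sub_self]
      obtain ⟨k, hk, hz⟩ := h.inj _ _ this
      rw [map_sub, rs_rs, rs_rs, sub_eq_zero] at hz
      rw [← h'.compat (hm.trans hk), ← h'.compat (hn.trans hk), hz]
    choose N0 X0 hX using h.surj
    have hspec : ∀ n x, ι' (N0 (ι n x)) (X0 (ι n x)) = ι' n x := fun n x => hw _ _ _ _ (hX _)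
    refine ⟨{ toFun := fun y => ι' (N0 y) (X0 y), map_add' := ?_, map_smul' := ?_ }, hspec⟩
    · intro y y'
      have e : y + y' = ι (max (N0 y) (N0 y')) (rs I (le_max_left _ _) N i (X0 y) +
          rs I (le_max_right _ _) N i (X0 y')) := by
        rw [map_add, h.compat, h.compat, hX, hX]
      conv_lhs => rw [e]
      rw [hspec, map_add, h'.compat, h'.compat]
    · intro r y
      have e : r • y = ι (N0 y) (r • X0 y) := by rw [map_smul, hX]
      conv_lhs => rw [e]
      rw [hspec, map_smul]; rfl
  obtain ⟨f, hf⟩ := key L L' ι ι' h h'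
  obtain ⟨g, hg⟩ := key L' L ι' ι h' h
  refine ⟨LinearEquiv.ofLinearMap f g ?_ ?_⟩
  · ext y
    obtain ⟨n, x, rfl⟩ := h'.surj y
    simp [hf, hg]
  · ext y
    obtain ⟨n, x, rfl⟩ := h.surj y
    simp [hf, hg]

open Limits in
lemma exists_isLC (i : ℕ) (N : ModuleCat.{u} R) : ∃ ι, IsLC I i N ((localCohomology I i).obj N) ι := by
  let F := localCohomology.diagram (localCohomology.idealPowersDiagram I) i
  let c : Cocone F := colimit.cocone F
  let G := F ⋙ (evaluation _ _).obj N
  let c' : Cocone G := ((evaluation _ _).obj N).mapCocone c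
  have hc : IsColimit c' := isColimitOfPreserves _ (colimit.isColimit F)
  have hp : PreservesFilteredColimitsOfSize.{0, 0} (forget (ModuleCat.{u} R)) :=
    preservesFilteredColimitsOfSize_shrink.{0, u, 0, u} _
  have hp2 : PreservesColimitsOfShape (ℕᵒᵖ)ᵒᵖ (forget (ModuleCat.{u} R)) := inferInstance
  let ι0 : ∀ n : ℕ, ((_root_.Ext R (ModuleCat.{u} R) i).obj (op (Qn I n))).obj N →ₗ[R] 
    (localCohomology I i).obj N := fun n => (c'.ι.app (op (op n))).hom
  have hmap : ∀ {m n : ℕ} (h : m ≤ n), G.map (homOfLE h).op.op = 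
      ((_root_.Ext R (ModuleCat.{u} R) i).map (tr I h).op).app N := fun h => rfl
  refine ⟨fun n => ι0 n ∘ₗ (extCmp (Qn I n) N i).symm.toLinearMap, ?_, ?_, ?_⟩
  · intro m n h x
    have hn := c'.w (homOfLE h).op.op
    obtain ⟨x, rfl⟩ := (extCmp (Qn I m) N i).surjective x
    rw [rs_apply, ← extCmp_nat]
    simp only [LinearMap.coe_comp, Function.comp_apply, LinearEquiv.coe_coe, LinearEquiv.symm_apply_apply]
    exact congrArg (fun z => z.hom x) hn
  · intro y
    obtain ⟨j, x, hx⟩ := Concrete.isColimit_exists_rep G hc y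
    refine ⟨unop (unop j), extCmp _ _ _ x, ?_⟩
    refine Eq.trans ?_ hx
    exact congrArg (ι0 (unop (unop j))) (LinearEquiv.symm_apply_apply (extCmp (Qn I (unop (unop j))) N i) x)
  · intro n x hx
    obtain ⟨x, rfl⟩ := (extCmp (Qn I n) N i).surjective x
    simp only [LinearMap.coe_comp, Function.comp_apply, LinearEquiv.coe_coe, LinearEquiv.symm_apply_apply] at hx
    have h0 : c'.ι.app (op (op n)) x = c'.ι.app (op (op n)) (0 : G.obj (op (op n))) := by
      rw [map_zero]; exact hx
    obtain ⟨k, f, g, hfg⟩ := Concrete.isColimit_exists_of_rep_eq G hc _ _ h0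
    have hk : n ≤ unop (unop k) := leOfHom f.unop.unop
    refine ⟨unop (unop k), hk, ?_⟩
    rw [map_zero] at hfg
    rw [rs_apply, ← extCmp_nat]
    refine (congrArg _ ?_).trans (map_zero (extCmp _ _ _))
    exact hfg
end lc


section les
open Abelian (Ext)
variable {A B C D : Type u} [AddCommGroup A] [Module R A] [AddCommGroup B] [Module R B]
  [AddCommGroup C] [Module R C] [AddCommGroup D] [Module R D]

/-- postcomposition on Ext -/
noncomputable def po (f : A →ₗ[R] B) (X : ModuleCat.{u} R) (i : ℕ) :
    Ext X (ModuleCat.of R A) i →ₗ[R] Ext X (ModuleCat.of R B) i :=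
  (Ext.mk₀ (ModuleCat.ofHom f)).postcompOfLinear R X (add_zero i)

lemma po_apply (f : A →ₗ[R] B) (X : ModuleCat.{u} R) (i : ℕ) (x : Ext X (ModuleCat.of R A) i) :
    po f X i x = x.comp (Ext.mk₀ (ModuleCat.ofHom f)) (add_zero i) := rfl

lemma po_comp (g : B →ₗ[R] C) (f : A →ₗ[R] B) (X : ModuleCat.{u} R) (i : ℕ)
    (x : Ext X (ModuleCat.of R A) i) : po g X i (po f X i x) = po (g ∘ₗ f) X i x := by
  simp only [po_apply]
  rw [Ext.comp_assoc_of_third_deg_zero, Ext.mk₀_comp_mk₀]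
  rfl

lemma po_id (X : ModuleCat.{u} R) (i : ℕ)
    (x : Ext X (ModuleCat.of R A) i) : po (LinearMap.id) X i x = x := by
  simp only [po_apply]
  exact Ext.comp_mk₀_id x

lemma po_lsmul (r : R) (X : ModuleCat.{u} R) (i : ℕ)
    (x : Ext X (ModuleCat.of R A) i) : po (LinearMap.lsmul R A r) X i x = r • x := by
  have : ModuleCat.ofHom (LinearMap.lsmul R A r) = r • 𝟙 (ModuleCat.of R A) := rfl
  rw [po_apply, this, Ext.mk₀_smul, Ext.comp_smul, Ext.comp_mk₀_id]

lemma smul_eq_zero_ext (r : R) (X : ModuleCat.{u} R) (hX : ∀ x : X, r • x = 0) (i : ℕ)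
    (x : Ext X (ModuleCat.of R A) i) : r • x = 0 := by
  have : r • 𝟙 X = 0 := by
    apply ModuleCat.hom_ext
    ext x
    exact hX x
  conv_lhs => rw [← Ext.mk₀_id_comp x]
  rw [← Ext.smul_comp, ← Ext.mk₀_smul, this, Ext.mk₀_zero, Ext.zero_comp]

lemma smul_eq_zero_ext' (r : R) (X : ModuleCat.{u} R) (hA : ∀ x : A, r • x = 0) (i : ℕ)
    (x : Ext X (ModuleCat.of R A) i) : r • x = 0 := by
  rw [← po_lsmul, po_apply]
  have : ModuleCat.ofHom (LinearMap.lsmul R A r) = 0 := by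
    apply ModuleCat.hom_ext
    ext x
    exact hA x
  rw [this, Ext.mk₀_zero, Ext.comp_zero]

/-- short exact sequences -/
structure SES (f : A →ₗ[R] B) (g : B →ₗ[R] C) : Prop where
  inj : Function.Injective f
  surj : Function.Surjective g
  exact : Function.Exact f g

/-- the short complex -/
noncomputable abbrev SES.sc {f : A →ₗ[R] B} {g : B →ₗ[R] C} (h : SES f g) : ShortComplex (ModuleCat.{u} R) :=
  ShortComplex.mk (ModuleCat.ofHom f) (ModuleCat.ofHom g) (by
    rw [← ModuleCat.ofHom_comp, h.exact.linearMap_comp_eq_zero]; rfl)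

lemma SES.se {f : A →ₗ[R] B} {g : B →ₗ[R] C} (h : SES f g) : h.sc.ShortExact where
  exact := (ShortComplex.ShortExact.moduleCat_exact_iff_function_exact _).2 h.exact
  mono_f := (ModuleCat.mono_iff_injective _).2 h.inj
  epi_g := (ModuleCat.epi_iff_surjective _).2 h.surj

/-- connecting map -/
noncomputable def SES.del {f : A →ₗ[R] B} {g : B →ₗ[R] C} (h : SES f g) (X : ModuleCat.{u} R) (i : ℕ) :
    Ext X (ModuleCat.of R C) i →ₗ[R] Ext X (ModuleCat.of R A) (i+1) :=
  h.se.extClass.postcompOfLinear R X rfl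

lemma SES.ex1 {f : A →ₗ[R] B} {g : B →ₗ[R] C} (h : SES f g) (X : ModuleCat.{u} R) (i : ℕ) :
    Function.Exact (h.del X i) (po f X (i+1)) :=
  (ShortComplex.ab_exact_iff_function_exact _).1 (Ext.covariant_sequence_exact₁' X h.se i (i+1) rfl)
lemma SES.ex2 {f : A →ₗ[R] B} {g : B →ₗ[R] C} (h : SES f g) (X : ModuleCat.{u} R) (i : ℕ) :
    Function.Exact (po f X i) (po g X i) :=
  (ShortComplex.ab_exact_iff_function_exact _).1 (Ext.covariant_sequence_exact₂' X h.se i)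
lemma SES.ex3 {f : A →ₗ[R] B} {g : B →ₗ[R] C} (h : SES f g) (X : ModuleCat.{u} R) (i : ℕ) :
    Function.Exact (po g X i) (h.del X i) :=
  (ShortComplex.ab_exact_iff_function_exact _).1 (Ext.covariant_sequence_exact₃' X h.se i (i+1) rfl)
lemma po_inj_zero {f : A →ₗ[R] B} (h : Function.Injective f) (X : ModuleCat.{u} R) :
    Function.Injective (po f X 0) := by
  have : Mono (ModuleCat.ofHom f) := (ModuleCat.mono_iff_injective _).2 h
  exact Ext.postcomp_mk₀_injective_of_mono X (ModuleCat.ofHom f)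

lemma rs_po (I : Ideal R) {m n : ℕ} (hmn : m ≤ n) (f : A →ₗ[R] B) (i : ℕ) (x) :
    rs I hmn _ i (po f (Qn I m) i x) = po f (Qn I n) i (rs I hmn _ i x) :=
  rs_post I hmn _ _ (add_zero i)
lemma SES.rs_del (I : Ideal R) {m n : ℕ} (hmn : m ≤ n) {f : A →ₗ[R] B} {g : B →ₗ[R] C} (h : SES f g) (i : ℕ) (x) :
    rs I hmn _ (i+1) (h.del (Qn I m) i x) = h.del (Qn I n) i (rs I hmn _ i x) :=
  rs_post I hmn _ _ rfl

lemma SES.of_injective {f : A →ₗ[R] B} (h : Function.Injective f) : SES f (f.range.mkQ) where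
  inj := h
  surj := Submodule.mkQ_surjective _
  exact := by
    rw [LinearMap.exact_iff, Submodule.ker_mkQ]

lemma SES.of_surjective {g : B →ₗ[R] C} (h : Function.Surjective g) : SES g.ker.subtype g where
  inj := Submodule.subtype_injective _
  surj := h
  exact := by
    rw [LinearMap.exact_iff, Submodule.range_subtype]

lemma SES.submodule (P : Submodule R B) : SES P.subtype P.mkQ where
  inj := Submodule.subtype_injective _
  surj := Submodule.mkQ_surjective _
  exact := by
    rw [LinearMap.exact_iff, Submodule.range_subtype, Submodule.ker_mkQ]

/-- finiteness of `Ext^i(R/I, T)` -/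
def FE (I : Ideal R) (i : ℕ) (T : Type u) [AddCommGroup T] [Module R T] : Prop :=
  Module.Finite R (Ext (ModuleCat.of R (R ⧸ I)) (ModuleCat.of R T) i)

lemma FE.of_equiv {I : Ideal R} {i : ℕ} (e : A ≃ₗ[R] B) (h : FE I i A) : FE I i B := by
  unfold FE at *
  refine Module.Finite.of_surjective (po e.toLinearMap _ i) ?_
  intro x
  refine ⟨po e.symm.toLinearMap _ i x, ?_⟩
  rw [po_comp]
  simp [po_id]

variable [IsNoetherianRing R]

lemma FE.of_finite {I : Ideal R} {i : ℕ} [Module.Finite R A] : FE I i A :=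
  ModuleCat.finite_ext _ _ _ _

lemma finite_mid {A B C : Type*} [AddCommGroup A] [Module R A] [AddCommGroup B] [Module R B]
  [AddCommGroup C] [Module R C] (f : A →ₗ[R] B) (g : B →ₗ[R] C) (h : Function.Exact f g) 
   (hA : Module.Finite R A) (hC : Module.Finite R C) : Module.Finite R B := by
  have h1 : g.ker.FG := by
    rw [(LinearMap.exact_iff.1 h)]
    rw [← Module.Finite.iff_fg]
    infer_instance
  have : IsNoetherian R C := isNoetherian_of_isNoetherianRing_of_finite R C
  have h2 : (⊤ : Submodule R B).FG := Submodule.fg_of_fg_map_of_fg_inf_ker g (IsNoetherian.noetherian _)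
    (by simpa using h1)
  exact ⟨h2⟩

lemma SES.fe2 {I : Ideal R} {i : ℕ} {f : A →ₗ[R] B} {g : B →ₗ[R] C} (h : SES f g) 
    (hA : FE I i A) (hC : FE I i C) : FE I i B := finite_mid _ _ (h.ex2 _ i) hA hC
lemma SES.fe3 {I : Ideal R} {i : ℕ} {f : A →ₗ[R] B} {g : B →ₗ[R] C} (h : SES f g) 
    (hB : FE I i B) (hA : FE I (i+1) A) : FE I i C := finite_mid _ _ (h.ex3 _ i) hB hA
lemma SES.fe1 {I : Ideal R} {i : ℕ} {f : A →ₗ[R] B} {g : B →ₗ[R] C} (h : SES f g) 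
    (hC : FE I i C) (hB : FE I (i+1) B) : FE I (i+1) A := finite_mid _ _ (h.ex1 _ i) hC hB
lemma FE.of_inj_zero {I : Ideal R} {f : A →ₗ[R] B} (h : Function.Injective f)
    (hB : FE I 0 B) : FE I 0 A := by
  unfold FE at *
  have := isNoetherian_of_isNoetherianRing_of_finite R (Ext (ModuleCat.of R (R ⧸ I)) (ModuleCat.of R B) 0)
  exact Module.Finite.of_injective _ (po_inj_zero h _)

/-- all Ext finite -/
def CF (I : Ideal R) (T : Type u) [AddCommGroup T] [Module R T] : Prop := ∀ i, FE I i T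

lemma CF.of_equiv {I : Ideal R} (e : A ≃ₗ[R] B) (h : CF I A) : CF I B := fun i => (h i).of_equiv e

lemma SES.cf1 {I : Ideal R} {f : A →ₗ[R] B} {g : B →ₗ[R] C} (h : SES f g) 
    (hB : CF I B) (hC : CF I C) : CF I A := fun i => by
  cases i with
  | zero => exact (hB 0).of_inj_zero h.inj
  | succ i => exact h.fe1 (hC i) (hB _)
lemma SES.cf2 {I : Ideal R} {f : A →ₗ[R] B} {g : B →ₗ[R] C} (h : SES f g) 
    (hA : CF I A) (hC : CF I C) : CF I B := fun i => h.fe2 (hA i) (hC i)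
lemma SES.cf3 {I : Ideal R} {f : A →ₗ[R] B} {g : B →ₗ[R] C} (h : SES f g) 
    (hA : CF I A) (hB : CF I B) : CF I C := fun i => h.fe3 (hB i) (hA _)

lemma smul_ext_quot {I : Ideal R} {r : R} (hr : r ∈ I) (i : ℕ) (x : Ext (ModuleCat.of R (R ⧸ I)) (ModuleCat.of R A) i) :
    r • x = 0 := by
  apply smul_eq_zero_ext
  rintro ⟨y⟩
  change Ideal.Quotient.mk I (r * y) = 0
  rw [Ideal.Quotient.eq_zero_iff_mem]
  exact Ideal.mul_mem_right _ _ hr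

/-- Melkersson's lemma -/
lemma melkersson {I : Ideal R} {r : R} (hr : r ∈ I) 
    (hK : CF I (LinearMap.lsmul R A r).ker) (hC : CF I (A ⧸ (LinearMap.lsmul R A r).range)) : CF I A := by
  set f := LinearMap.lsmul R A r
  intro i
  have s1 : SES f.ker.subtype f.rangeRestrict := by
    have := SES.of_surjective (g := f.rangeRestrict) f.surjective_rangeRestrict
    have e : f.rangeRestrict.ker = f.ker := LinearMap.ker_rangeRestrict f
    refine ⟨Submodule.subtype_injective _, f.surjective_rangeRestrict, ?_⟩
    rw [LinearMap.exact_iff, Submodule.range_subtype, e]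
  have s2 : SES f.range.subtype f.range.mkQ := SES.submodule _
  have hcomp : ∀ x, po f.range.subtype (ModuleCat.of R (R ⧸ I)) i (po f.rangeRestrict _ i x) = 0 := by
    intro x
    rw [po_comp]
    change po (LinearMap.lsmul R A r) _ _ _ = 0
    rw [po_lsmul, smul_ext_quot hr]
  -- kernel of `po subtype` is finite
  have hker : Module.Finite R (po f.range.subtype (ModuleCat.of R (R ⧸ I)) i).ker := by
    cases i with
    | zero =>
      rw [LinearMap.ker_eq_bot.2 (po_inj_zero (Submodule.subtype_injective _) _)]
      infer_instance
    | succ i =>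
      rw [LinearMap.exact_iff.1 (s2.ex1 _ i)]
      have : Module.Finite R (Ext (ModuleCat.of R (R ⧸ I)) (ModuleCat.of R (A ⧸ f.range)) i) := hC i
      infer_instance
  have hK' : Module.Finite R (Ext (ModuleCat.of R (R ⧸ I)) (ModuleCat.of R f.ker) i) := hK i
  refine finite_mid (po f.ker.subtype _ i) 
    ((po f.rangeRestrict (ModuleCat.of R (R ⧸ I)) i).codRestrict (po f.range.subtype (ModuleCat.of R (R ⧸ I)) i).ker hcomp) ?_ hK' hker
  intro x
  rw [← s1.ex2 _ i x]
  exact Subtype.ext_iff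

lemma finite_ext_zero_iff (J : Ideal R) : FE J 0 A ↔ Module.Finite R (Submodule.torsionBySet R A J) := by
  let e1 : Ext (ModuleCat.of R (R ⧸ J)) (ModuleCat.of R A) 0 ≃ₗ[R] ((R ⧸ J) →ₗ[R] A) :=
    Ext.linearEquiv₀.trans ModuleCat.homLinearEquiv
  let f : ((R ⧸ J) →ₗ[R] A) →ₗ[R] A := LinearMap.applyₗ (1 : R ⧸ J)
  have hf : Function.Injective f := by
    intro x y h
    apply Submodule.linearMap_qext
    ext
    exact h
  have hr : f.range = Submodule.torsionBySet R A J := by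
    ext a
    rw [Submodule.mem_torsionBySet_iff]
    constructor
    · rintro ⟨x, rfl⟩ ⟨j, hj⟩
      change j • x 1 = 0
      rw [← map_smul]
      have : j • (1 : R ⧸ J) = 0 := by
        change Ideal.Quotient.mk J (j * 1) = 0
        rw [Ideal.Quotient.eq_zero_iff_mem]; simpa using hj
      rw [this, map_zero]
    · intro h
      refine ⟨Submodule.liftQ J (LinearMap.toSpanSingleton R A a) ?_, ?_⟩
      · intro j hj
        exact h ⟨j, hj⟩
      · change (1 : R) • a = a
        simp
  have e2 := (LinearEquiv.ofInjective f hf).trans (LinearEquiv.ofEq _ _ hr)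
  exact Module.Finite.equiv_iff (e1.trans e2)

end les


section art
universe v w

/-- elementwise torsion + Artinian socle implies Artinian -/
lemma artinian_of_torsionBy {S : Type v} [CommRing S] {T : Type w} [AddCommGroup T] [Module S T] (a : S)
    (htor : ∀ t : T, ∃ n : ℕ, a ^ n • t = 0) (h : IsArtinian S (Submodule.torsionBy S T a)) :
    IsArtinian S T := by
  rw [← monotone_stabilizes_iff_artinian]
  intro f
  let N : ℕ → Submodule S T := fun k => OrderDual.ofDual (f k)
  have hN : ∀ {k l}, k ≤ l → N l ≤ N k := fun h => f.monotone h
  let V : ℕ → ℕ → Submodule S (Submodule.torsionBy S T a) := fun n k =>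
    { carrier := {x | ∃ y ∈ N k, a ^ (n+1) • y = 0 ∧ a ^ n • y = x}
      zero_mem' := ⟨0, zero_mem _, by simp, by simp⟩
      add_mem' := by
        rintro x x' ⟨y, hy, h1, h2⟩ ⟨y', hy', h1', h2'⟩
        exact ⟨y + y', add_mem hy hy', by simp [smul_add, h1, h1'], by simp [smul_add, h2, h2']⟩
      smul_mem' := by
        rintro r x ⟨y, hy, h1, h2⟩
        exact ⟨r • y, Submodule.smul_mem _ _ hy, by rw [smul_comm, h1, smul_zero], by
          rw [smul_comm, h2]; rfl⟩ }
  have hVk : ∀ n {k l}, k ≤ l → V n l ≤ V n k := by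
    rintro n k l h x ⟨y, hy, h1⟩
    exact ⟨y, hN h hy, h1⟩
  have hVn1 : ∀ n k, V (n+1) k ≤ V n k := by
    rintro n k x ⟨y, hy, h1, h2⟩
    exact ⟨a • y, Submodule.smul_mem _ _ hy, by rw [← mul_smul, ← pow_succ, h1], by
      rw [← mul_smul, ← pow_succ, h2]⟩
  have hVn : ∀ k {n m}, n ≤ m → V m k ≤ V n k := by
    intro k n m h
    exact antitone_nat_of_succ_le (f := fun n => V n k) (fun n => hVn1 n k) h
  obtain ⟨X, ⟨⟨n0, k0⟩, rfl⟩, hmin⟩ := IsArtinian.set_has_minimal (Set.range fun p : ℕ × ℕ => V p.1 p.2)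
    (Set.range_nonempty _)
  have hst : ∀ n k, n0 ≤ n → k0 ≤ k → V n k = V n0 k0 := by
    intro n k hn hk
    have hle : V n k ≤ V n0 k0 := (hVk _ hk).trans (hVn _ hn)
    by_contra hne
    exact hmin _ ⟨(n, k), rfl⟩ (lt_of_le_of_ne hle hne)
  have hst2 : ∀ n, ∃ k, ∀ l, k ≤ l → V n k = V n l := by
    intro n
    exact IsArtinian.monotone_stabilizes (R := S) ⟨fun k => OrderDual.toDual (V n k), fun k l h => hVk n h⟩
  choose g hg using hst2
  let K := max k0 ((Finset.range n0).sup g)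
  have hK : ∀ n k, K ≤ k → V n k = V n K := by
    intro n k hk
    by_cases hn : n0 ≤ n
    · rw [hst n k hn ((le_max_left _ _).trans hk), hst n K hn (le_max_left _ _)]
    · have hgn : g n ≤ K := (Finset.le_sup (f := g) (by simpa using hn)).trans (le_max_right _ _)
      rw [← hg n k (hgn.trans hk), ← hg n K hgn]
  refine ⟨K, fun k hk => ?_⟩
  have key : ∀ n, ∀ y ∈ N K, a ^ n • y = 0 → y ∈ N k := by
    intro n
    induction n with
    | zero => intro y _ h0; simp only [pow_zero, one_smul] at h0; rw [h0]; exact zero_mem _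
    | succ n ih =>
      intro y hy h0
      have h1 : (⟨a ^ n • y, by rw [Submodule.mem_torsionBy_iff, ← mul_smul, ← pow_succ', h0]⟩ : Submodule.torsionBy S T a) ∈ V n K := ⟨y, hy, h0, rfl⟩
      rw [← hK n k hk] at h1
      obtain ⟨y', hy', h2, h3⟩ := h1
      have h4 : y - y' ∈ N k := ih _ (sub_mem hy (hN hk hy')) (by rw [smul_sub, h3]; simp)
      simpa using add_mem h4 hy'
  have : N K = N k := le_antisymm (fun y hy => by
    obtain ⟨n, hn⟩ := htor y
    exact key n y hy hn) (hN hk)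
  exact this

lemma artinian_of_torsionBySet {S : Type v} [CommRing S] {T : Type w} [AddCommGroup T] [Module S T] (s : Finset S)
    (htor : ∀ a ∈ s, ∀ t : T, ∃ n : ℕ, a ^ n • t = 0) (h : IsArtinian S (Submodule.torsionBySet S T (s : Set S))) :
    IsArtinian S T := by
  classical
  induction s using Finset.induction with
  | empty =>
    have : Submodule.torsionBySet S T ((∅ : Finset S) : Set S) = ⊤ := by
      ext; simp [Submodule.mem_torsionBySet_iff]
    rw [this] at h
    exact (LinearEquiv.isArtinian_iff Submodule.topEquiv).1 h
  | insert a s ha ih =>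
    apply ih (fun b hb => htor b (Finset.mem_insert_of_mem hb))
    apply artinian_of_torsionBy a
    · intro t
      obtain ⟨n, hn⟩ := htor a (Finset.mem_insert_self _ _) t.1
      exact ⟨n, Subtype.ext hn⟩
    · let f : Submodule.torsionBy S (Submodule.torsionBySet S T (s : Set S)) a →ₗ[S]
        Submodule.torsionBySet S T ((insert a s : Finset S) : Set S) :=
          LinearMap.codRestrict _ ((Submodule.subtype _) ∘ₗ (Submodule.subtype _)) (by
            intro x
            rw [Submodule.mem_torsionBySet_iff]
            rintro ⟨b, hb⟩
            rw [Finset.mem_coe, Finset.mem_insert] at hb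
            rcases hb with rfl | hb
            · exact congrArg Subtype.val ((Submodule.mem_torsionBy_iff _ _).1 x.2)
            · exact (Submodule.mem_torsionBySet_iff _ _).1 x.1.2 ⟨b, hb⟩)
      exact isArtinian_of_injective f (by
        intro x y hxy
        apply Subtype.ext
        apply Subtype.ext
        exact congrArg (fun z => z.1) hxy)

lemma artinian_of_primes {S : Type v} [CommRing S] [IsNoetherianRing S] {T : Type w} [AddCommGroup T] [Module S T]
    [Module.Finite S T] (h : ∀ q : Ideal S, q.IsPrime → Module.annihilator S T ≤ q → q.IsMaximal) :
    IsArtinian S T := by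
  have hd : Ring.KrullDimLE 0 (S ⧸ Module.annihilator S T) := by
    apply Ring.KrullDimLE.mk₀
    intro q hq
    have hle : Module.annihilator S T ≤ q.comap (Ideal.Quotient.mk (Module.annihilator S T)) := by
      intro x hx
      rw [Ideal.mem_comap, Ideal.Quotient.eq_zero_iff_mem.2 hx]
      exact zero_mem _
    have hm := h _ (Ideal.IsPrime.comap _ (hK := hq)) hle
    have := Ideal.map_eq_top_or_isMaximal_of_surjective _ (Ideal.Quotient.mk_surjective (I := Module.annihilator S T)) hm
    rw [Ideal.map_comap_of_surjective _ Ideal.Quotient.mk_surjective] at this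
    exact this.resolve_left hq.ne_top
  have ha : IsArtinianRing (S ⧸ Module.annihilator S T) := IsNoetherianRing.isArtinianRing_of_krullDimLE_zero
  have htb := Module.isTorsionBySet_annihilator S T
  let _ := htb.module
  have : IsScalarTower S (S ⧸ Module.annihilator S T) T := htb.isScalarTower
  have : Module.Finite (S ⧸ Module.annihilator S T) T := Module.Finite.of_restrictScalars_finite S _ _
  have h1 : IsArtinian (S ⧸ Module.annihilator S T) T := inferInstance
  exact (LinearMap.isArtinian_iff_of_bijective htb.semilinearMap Function.bijective_id).2 h1

/-- zero dimensional case -/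
lemma artinian_zero_dim {S : Type v} [CommRing S] [IsNoetherianRing S] {T : Type w} [AddCommGroup T] [Module S T]
    (I : Ideal S) (htor : ∀ t : T, ∃ n : ℕ, ∀ a ∈ I ^ n, a • t = 0)
    (hf : Module.Finite S (Submodule.torsionBySet S T (I : Set S))) 
    (hp : ∀ t : T, ∀ q : Ideal S, q.IsPrime → Ideal.torsionOf S T t ≤ q → q.IsMaximal) : IsArtinian S T := by
  obtain ⟨s, hs⟩ := IsNoetherian.noetherian I
  refine artinian_of_torsionBySet s ?_ ?_
  · intro a ha t
    obtain ⟨n, hn⟩ := htor t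
    exact ⟨n, hn _ (Ideal.pow_mem_pow (by rw [← hs]; exact Submodule.subset_span ha) n)⟩
  · have : Submodule.torsionBySet S T (s : Set S) = Submodule.torsionBySet S T (I : Set S) := by
      rw [Submodule.torsionBySet_eq_torsionBySet_span (s := (s : Set S)), ← hs]
    rw [this]
    obtain ⟨g, hg⟩ := hf.1
    apply artinian_of_primes
    intro q hq hle
    have h2 : ∏ t ∈ g, Ideal.torsionOf S T t.1 ≤ q := by
      refine le_trans ?_ hle
      intro r hr
      rw [Module.mem_annihilator]
      intro m
      have hm : m ∈ Submodule.span S (g : Set (Submodule.torsionBySet S T (I : Set S))) := by rw [hg]; trivial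
      induction hm using Submodule.span_induction with
      | mem x hx => 
        apply Subtype.ext
        change r • x.1 = 0
        rw [← Ideal.mem_torsionOf_iff]
        exact (Ideal.prod_le_inf.trans (Finset.inf_le (Finset.mem_coe.1 hx))) hr
      | zero => simp
      | add x y _ _ hx hy => rw [smul_add, hx, hy, add_zero]
      | smul c x _ hx => rw [smul_comm, hx, smul_zero]
    obtain ⟨t, _, ht⟩ := (hq.prod_le).1 h2
    exact hp _ q hq ht

/-- generic stabilization at a minimal prime -/
lemma generic_stab {S : Type v} [CommRing S] [IsNoetherianRing S] {T : Type w} [AddCommGroup T] [Module S T]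
    (I b p : Ideal S) (hI : I ≤ b) (hp : p ∈ b.minimalPrimes)
    (htor : ∀ t : T, ∃ n : ℕ, ∀ a ∈ b ^ n, a • t = 0)
    (hf : Module.Finite S (Submodule.torsionBySet S T (I : Set S))) (a : S) :
    ∃ k, ∀ t : T, ∃ s ∉ p, ∃ t' : T, s • a ^ k • t = a ^ (k+1) • t' := by
  have hpp : p.IsPrime := hp.1.1
  let Sp := Localization.AtPrime p
  let Tp := LocalizedModule p.primeCompl T
  have hann : ∀ t : Tp, ∃ n : ℕ, (b ^ n).map (algebraMap S Sp) ≤ Ideal.torsionOf Sp Tp t := by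
    intro t
    induction t using LocalizedModule.induction_on with
    | h m s =>
    obtain ⟨n, hn⟩ := htor m
    refine ⟨n, ?_⟩
    rw [Ideal.map_le_iff_le_comap]
    intro x hx
    rw [Ideal.mem_comap, Ideal.mem_torsionOf_iff, algebraMap_smul, LocalizedModule.smul'_mk, hn x hx,
      LocalizedModule.zero_mk]
  have hart : IsArtinian Sp Tp := by
    apply artinian_zero_dim (I.map (algebraMap S Sp))
    · intro t
      obtain ⟨n, hn⟩ := hann t
      refine ⟨n, fun x hx => ?_⟩
      rw [← Ideal.map_pow] at hx
      exact (Ideal.mem_torsionOf_iff _ _).1 (hn (Ideal.map_mono (Ideal.pow_right_mono hI n) hx))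
    · obtain ⟨g, hg⟩ := hf.1
      obtain ⟨gi, hgi⟩ := IsNoetherian.noetherian I
      classical
      rw [Module.Finite.iff_fg]
      refine ⟨g.image (fun t => LocalizedModule.mkLinearMap p.primeCompl T t.1), ?_⟩
      apply le_antisymm
      · rw [Submodule.span_le]
        intro x hx
        rw [Finset.mem_coe, Finset.mem_image] at hx
        obtain ⟨t, _, rfl⟩ := hx
        rw [SetLike.mem_coe, Submodule.mem_torsionBySet_iff]
        rintro ⟨x, hx⟩
        rw [← Ideal.mem_torsionOf_iff]
        revert hx x
        change I.map (algebraMap S Sp) ≤ _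
        rw [Ideal.map_le_iff_le_comap]
        intro x hx
        rw [Ideal.mem_comap, Ideal.mem_torsionOf_iff, algebraMap_smul, ← map_smul,
          (Submodule.mem_torsionBySet_iff _ _).1 t.2 ⟨x, hx⟩, map_zero]
      · intro t ht
        rw [Submodule.mem_torsionBySet_iff] at ht
        induction t using LocalizedModule.induction_on with
        | h m s =>
        have h1 : ∀ x ∈ gi, ∃ u : p.primeCompl, u • x • m = 0 := by
          intro x hx
          have hxI : x ∈ I := by rw [← hgi]; exact Submodule.subset_span hx
          have := ht ⟨algebraMap S Sp x, Ideal.mem_map_of_mem _ hxI⟩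
          change algebraMap S Sp x • LocalizedModule.mk m s = 0 at this
          rw [algebraMap_smul, LocalizedModule.smul'_mk, ← LocalizedModule.zero_mk s, LocalizedModule.mk_eq] at this
          obtain ⟨u, hu⟩ := this
          refine ⟨u * s, ?_⟩
          rw [mul_smul, hu, smul_zero, smul_zero]
        choose! u hu using h1
        let U := ∏ x ∈ gi, u x
        have hU : ∀ x ∈ I, x • (U • m) = 0 := by
          intro x hx
          rw [← Ideal.mem_torsionOf_iff]
          revert hx x
          change I ≤ _
          rw [← hgi, Submodule.span_le]
          intro x hx
          rw [SetLike.mem_coe, Ideal.mem_torsionOf_iff, smul_comm]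
          obtain ⟨c, hc⟩ := Finset.dvd_prod_of_mem u hx
          change (∏ x ∈ gi, u x) • x • m = 0
          rw [hc, mul_comm, mul_smul, hu x hx, smul_zero]
        let m' : Submodule.torsionBySet S T (I : Set S) := ⟨U • m, (Submodule.mem_torsionBySet_iff _ _).2 fun x => hU x.1 x.2⟩
        have e : LocalizedModule.mk m s = (Localization.mk 1 (U * s) : Sp) • LocalizedModule.mkLinearMap p.primeCompl T m'.1 := by
          rw [LocalizedModule.mkLinearMap_apply, LocalizedModule.mk_smul_mk, one_smul, mul_one]
          rw [LocalizedModule.mk_cancel_common_left]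
        rw [e]
        apply Submodule.smul_mem
        have hm' : m' ∈ Submodule.span S (g : Set (Submodule.torsionBySet S T (I : Set S))) := by rw [hg]; trivial
        generalize m' = y at hm'
        induction hm' using Submodule.span_induction with
        | mem x hx => exact Submodule.subset_span (by
            rw [Finset.mem_coe, Finset.mem_image]; exact ⟨x, hx, rfl⟩)
        | zero => simp
        | add x y _ _ hx hy => 
          rw [Submodule.coe_add, map_add]; exact add_mem hx hy
        | smul c x _ hx => 
          rw [Submodule.coe_smul, map_smul, ← algebraMap_smul Sp c]
          exact Submodule.smul_mem _ _ hx
    · intro t q hq hle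
      obtain ⟨n, hn⟩ := hann t
      have hle2 : b ≤ q.comap (algebraMap S Sp) := by
        have h3 : (b.map (algebraMap S Sp)) ^ n ≤ q := by rw [← Ideal.map_pow]; exact hn.trans hle
        exact Ideal.map_le_iff_le_comap.1 (hq.le_of_pow_le h3)
      have hcp : (q.comap (algebraMap S Sp)).IsPrime := Ideal.IsPrime.comap _
      have hqm : q ≤ IsLocalRing.maximalIdeal Sp := IsLocalRing.le_maximalIdeal hq.ne_top
      have hle3 : q.comap (algebraMap S Sp) ≤ p := by
        have := Ideal.comap_mono (f := algebraMap S Sp) hqm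
        rwa [show Ideal.comap (algebraMap S Sp) (IsLocalRing.maximalIdeal Sp) = p from IsLocalization.AtPrime.under_maximalIdeal Sp p] at this
      have h5 : q.comap (algebraMap S Sp) = p := le_antisymm hle3 (hp.2 ⟨hcp, hle2⟩ hle3)
      have h6 : q = IsLocalRing.maximalIdeal Sp := by
        rw [← IsLocalization.map_under p.primeCompl Sp q, show Ideal.under S q = p from h5, Localization.AtPrime.map_eq_maximalIdeal]
      rw [h6]; infer_instance
  obtain ⟨k, hk⟩ := IsArtinian.range_smul_pow_stabilizes Tp (algebraMap S Sp a)
  refine ⟨k, fun t => ?_⟩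
  have h1 : (algebraMap S Sp a) ^ k • (LocalizedModule.mkLinearMap p.primeCompl T t) ∈ 
      LinearMap.range ((algebraMap S Sp a) ^ k • LinearMap.id : Tp →ₗ[Sp] Tp) := ⟨_, rfl⟩
  rw [hk (k+1) (Nat.le_succ k)] at h1
  obtain ⟨y, hy⟩ := h1
  induction y using LocalizedModule.induction_on with
  | h m s =>
  simp only [LinearMap.smul_apply, LinearMap.id_apply, ← map_pow, algebraMap_smul, LocalizedModule.smul'_mk,
    LocalizedModule.mkLinearMap_apply] at hy
  rw [LocalizedModule.smul'_mk, LocalizedModule.mk_eq] at hy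
  obtain ⟨u, hu⟩ := hy
  refine ⟨(u * s : p.primeCompl), (u * s).2, (u : S) • m, ?_⟩
  simp only [one_smul] at hu
  rw [smul_comm (a ^ (k+1))]
  change (u * s) • a ^ k • t = u • a ^ (k+1) • m
  rw [hu, mul_smul]
end art


section crit
variable [IsNoetherianRing R]

/-- elementwise power torsion -/
def Tor (b : Ideal R) (T : Type u) [AddCommGroup T] [Module R T] : Prop :=
  ∀ t : T, ∃ n : ℕ, ∀ a ∈ b ^ n, a • t = 0

lemma Tor.of_inj {b : Ideal R} {A B : Type u} [AddCommGroup A] [Module R A] [AddCommGroup B] [Module R B]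
    (f : A →ₗ[R] B) (hf : Function.Injective f) (h : Tor b B) : Tor b A := fun t => by
  obtain ⟨n, hn⟩ := h (f t)
  exact ⟨n, fun a ha => hf (by rw [map_smul, hn a ha, map_zero])⟩

lemma Tor.of_surj {b : Ideal R} {A B : Type u} [AddCommGroup A] [Module R A] [AddCommGroup B] [Module R B]
    (f : A →ₗ[R] B) (hf : Function.Surjective f) (h : Tor b A) : Tor b B := fun t => by
  obtain ⟨t, rfl⟩ := hf t
  obtain ⟨n, hn⟩ := h t
  exact ⟨n, fun a ha => (by rw [← map_smul, hn a ha, map_zero])⟩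

lemma Tor.mono {b I : Ideal R} {A : Type u} [AddCommGroup A] [Module R A] (hI : I ≤ b)
    (h : Tor b A) : Tor I A := fun t => by
  obtain ⟨n, hn⟩ := h t
  exact ⟨n, fun a ha => hn a (Ideal.pow_right_mono hI n ha)⟩

lemma finite_of_nilp {T : Type u} [AddCommGroup T] [Module R T] (a : R) (n : ℕ) (hn : ∀ t : T, a ^ n • t = 0)
    (h : Module.Finite R (Submodule.torsionBy R T a)) : Module.Finite R T := by
  induction n generalizing T with
  | zero =>
    have : Subsingleton T := subsingleton_of_forall_eq 0 (fun t => by simpa using hn t)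
    infer_instance
  | succ n ih =>
    have h1 : Module.Finite R (LinearMap.lsmul R T a).range := by
      apply ih
      · rintro ⟨_, t, rfl⟩
        apply Subtype.ext
        change a ^ n • a • t = 0
        rw [← mul_smul, ← pow_succ, hn]
      · have := isNoetherian_of_isNoetherianRing_of_finite R (Submodule.torsionBy R T a)
        let f : Submodule.torsionBy R (LinearMap.lsmul R T a).range a →ₗ[R] Submodule.torsionBy R T a :=
          LinearMap.codRestrict _ (Submodule.subtype _ ∘ₗ Submodule.subtype _) (by
            intro x
            exact congrArg (fun z => z.1) ((Submodule.mem_torsionBy_iff _ _).1 x.2))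
        exact Module.Finite.of_injective f (by
          intro x y hxy
          apply Subtype.ext
          apply Subtype.ext
          exact congrArg (fun z => z.1) hxy)
    refine finite_mid (Submodule.torsionBy R T a).subtype (LinearMap.lsmul R T a).rangeRestrict ?_ h h1
    rw [LinearMap.exact_iff, Submodule.range_subtype, LinearMap.ker_rangeRestrict]
    rfl

lemma finite_of_nilp_set {T : Type u} [AddCommGroup T] [Module R T] (s : Finset R)
    (hn : ∀ a ∈ s, ∃ n : ℕ, ∀ t : T, a ^ n • t = 0)
    (h : Module.Finite R (Submodule.torsionBySet R T (s : Set R))) : Module.Finite R T := by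
  classical
  induction s using Finset.induction with
  | empty =>
    have : Submodule.torsionBySet R T ((∅ : Finset R) : Set R) = ⊤ := by
      ext; simp [Submodule.mem_torsionBySet_iff]
    rw [this] at h
    exact Module.Finite.equiv Submodule.topEquiv
  | insert a s ha ih =>
    apply ih (fun b hb => hn b (Finset.mem_insert_of_mem hb))
    obtain ⟨n, hn⟩ := hn a (Finset.mem_insert_self _ _)
    apply finite_of_nilp a n
    · intro t
      exact Subtype.ext (hn t.1)
    · let f : Submodule.torsionBy R (Submodule.torsionBySet R T (s : Set R)) a →ₗ[R]
        Submodule.torsionBySet R T ((insert a s : Finset R) : Set R) :=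
          LinearMap.codRestrict _ ((Submodule.subtype _) ∘ₗ (Submodule.subtype _)) (by
            intro x
            rw [Submodule.mem_torsionBySet_iff]
            rintro ⟨b, hb⟩
            rw [Finset.mem_coe, Finset.mem_insert] at hb
            rcases hb with rfl | hb
            · exact congrArg Subtype.val ((Submodule.mem_torsionBy_iff _ _).1 x.2)
            · exact (Submodule.mem_torsionBySet_iff _ _).1 x.1.2 ⟨b, hb⟩)
      have := isNoetherian_of_isNoetherianRing_of_finite R 
        (Submodule.torsionBySet R T ((insert a s : Finset R) : Set R))
      exact Module.Finite.of_injective f (by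
        intro x y hxy
        apply Subtype.ext
        apply Subtype.ext
        exact congrArg (fun z => z.1) hxy)

lemma ker_cf {I : Ideal R} {T : Type u} [AddCommGroup T] [Module R T] (a : R) (k : ℕ)
    (h0 : CF I (Submodule.torsionBy R T (a ^ k))) (h1 : CF I (Submodule.torsionBy R T (a ^ (k+1)))) :
    CF I (LinearMap.lsmul R (T ⧸ Submodule.torsionBy R T (a ^ k)) a).ker := by
  have hle : Submodule.torsionBy R T (a ^ k) ≤ Submodule.torsionBy R T (a ^ (k+1)) :=
    Submodule.torsionBy_le_torsionBy_of_dvd _ _ (pow_dvd_pow _ (Nat.le_succ k))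
  let g : Submodule.torsionBy R T (a ^ (k+1)) →ₗ[R] 
      (LinearMap.lsmul R (T ⧸ Submodule.torsionBy R T (a ^ k)) a).ker :=
    LinearMap.codRestrict _ ((Submodule.mkQ _) ∘ₗ (Submodule.subtype _)) (by
      intro x
      rw [LinearMap.mem_ker]
      change a • Submodule.Quotient.mk (p := Submodule.torsionBy R T (a ^ k)) x.1 = 0
      rw [← Submodule.Quotient.mk_smul, Submodule.Quotient.mk_eq_zero, Submodule.mem_torsionBy_iff,
        ← mul_smul, ← pow_succ]
      exact (Submodule.mem_torsionBy_iff _ _).1 x.2)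
  have s : SES (Submodule.inclusion hle) g := by
    refine ⟨Submodule.inclusion_injective hle, ?_, ?_⟩
    · rintro ⟨y, hy⟩
      obtain ⟨y, rfl⟩ := Submodule.Quotient.mk_surjective _ y
      rw [LinearMap.mem_ker] at hy
      change a • Submodule.Quotient.mk (p := Submodule.torsionBy R T (a ^ k)) y = 0 at hy
      rw [← Submodule.Quotient.mk_smul, Submodule.Quotient.mk_eq_zero, Submodule.mem_torsionBy_iff,
        ← mul_smul, ← pow_succ] at hy
      exact ⟨⟨y, (Submodule.mem_torsionBy_iff _ _).2 hy⟩, rfl⟩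
    · intro y
      constructor
      · intro h
        have h' : Submodule.Quotient.mk (p := Submodule.torsionBy R T (a ^ k)) y.1 = 0 := congrArg (fun z => z.1) h
        rw [Submodule.Quotient.mk_eq_zero] at h'
        exact ⟨⟨y.1, h'⟩, rfl⟩
      · rintro ⟨x, rfl⟩
        apply Subtype.ext
        change Submodule.Quotient.mk (p := Submodule.torsionBy R T (a ^ k)) x.1 = 0
        rw [Submodule.Quotient.mk_eq_zero]
        exact x.2
  exact s.cf3 h0 h1

lemma core {I : Ideal R} (H : ∀ (T : Type u) [AddCommGroup T] [Module R T], Prop)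
    (h0 : ∀ (T : Type u) [AddCommGroup T] [Module R T], H T → FE I 0 T)
    (hx : ∀ (T : Type u) [AddCommGroup T] [Module R T], H T → ∀ x : R, H (Submodule.torsionBy R T x))
    (hstep : ∀ (T : Type u) [AddCommGroup T] [Module R T], H T → ∀ a ∈ I, ∃ k : ℕ, 
      CF I (Submodule.torsionBy R T (a ^ k)) → CF I (Submodule.torsionBy R T (a ^ (k+1))) →
      CF I ((T ⧸ Submodule.torsionBy R T (a ^ k)) ⧸ (LinearMap.lsmul R (T ⧸ Submodule.torsionBy R T (a ^ k)) a).range))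
    (T : Type u) [AddCommGroup T] [Module R T] (hT : H T) : CF I T := by
  classical
  obtain ⟨s, hs⟩ := IsNoetherian.noetherian I
  suffices key : ∀ s' : Finset R, s' ⊆ s → ∀ (T : Type u) [AddCommGroup T] [Module R T], H T → 
      (∀ a ∈ s, a ∉ s' → ∃ n : ℕ, ∀ t : T, a ^ n • t = 0) → CF I T from
    key s (le_refl _) T hT (fun a h h' => absurd h h')
  intro s' hs'
  induction s' using Finset.induction with
  | empty =>
    intro T _ _ hT hn
    have : Module.Finite R T := by
      apply finite_of_nilp_set s (fun a ha => hn a ha (by simp))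
      have : Submodule.torsionBySet R T (s : Set R) = Submodule.torsionBySet R T (I : Set R) := by
        rw [Submodule.torsionBySet_eq_torsionBySet_span (s := (s : Set R)), ← hs]
      rw [this]
      exact (finite_ext_zero_iff I).1 (h0 T hT)
    exact fun i => FE.of_finite
  | insert a s' ha ih =>
    intro T _ _ hT hn
    have haI : a ∈ I := by rw [← hs]; exact Submodule.subset_span (hs' (Finset.mem_insert_self _ _))
    obtain ⟨k, hk⟩ := hstep T hT a haI
    have hU : ∀ m, CF I (Submodule.torsionBy R T (a ^ m)) := by
      intro m
      apply ih (fun x hx => hs' (Finset.mem_insert_of_mem hx)) _ (hx T hT _)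
      intro b hb hb'
      by_cases hba : b = a
      · subst hba
        exact ⟨m, fun t => Submodule.smul_torsionBy _ _⟩
      · obtain ⟨n, hn⟩ := hn b hb (by simp [hba, hb'])
        exact ⟨n, fun t => Subtype.ext (hn t.1)⟩
    have h2 := melkersson haI (ker_cf a k (hU k) (hU (k+1))) (hk (hU k) (hU (k+1)))
    exact (SES.submodule (Submodule.torsionBy R T (a ^ k))).cf2 (hU k) h2

lemma cf_zero_dim {I : Ideal R} (T : Type u) [AddCommGroup T] [Module R T] (htor : Tor I T)
    (hp : ∀ t : T, ∀ q : Ideal R, q.IsPrime → Ideal.torsionOf R T t ≤ q → q.IsMaximal)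
    (hf : FE I 0 T) : CF I T := by
  apply core (I := I) (fun T _ _ => Tor I T ∧ 
    (∀ t : T, ∀ q : Ideal R, q.IsPrime → Ideal.torsionOf R T t ≤ q → q.IsMaximal) ∧ FE I 0 T)
  · intro T _ _ h; exact h.2.2
  · intro T _ _ h x
    refine ⟨h.1.of_inj (Submodule.subtype _) (Submodule.subtype_injective _), ?_, 
      h.2.2.of_inj_zero (Submodule.subtype_injective _)⟩
    intro t q hq hle
    apply h.2.1 t.1 q hq
    intro r hr
    apply hle
    rw [Ideal.mem_torsionOf_iff] at hr ⊢
    exact Subtype.ext hr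
  · intro T _ _ h a ha
    have : IsArtinian R T := artinian_zero_dim I h.1 ((finite_ext_zero_iff I).1 h.2.2) h.2.1
    obtain ⟨k, hk⟩ := IsArtinian.range_smul_pow_stabilizes T a
    refine ⟨k, fun _ _ => ?_⟩
    have : Subsingleton ((T ⧸ Submodule.torsionBy R T (a ^ k)) ⧸ 
        (LinearMap.lsmul R (T ⧸ Submodule.torsionBy R T (a ^ k)) a).range) := by
      rw [Submodule.Quotient.subsingleton_iff, eq_top_iff]
      rintro y -
      obtain ⟨y, rfl⟩ := Submodule.Quotient.mk_surjective _ y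
      have h1 : a ^ k • y ∈ LinearMap.range (a ^ k • LinearMap.id : T →ₗ[R] T) := ⟨y, rfl⟩
      rw [hk (k+1) (Nat.le_succ k)] at h1
      obtain ⟨z, hz⟩ := h1
      refine ⟨Submodule.Quotient.mk z, ?_⟩
      change a • Submodule.Quotient.mk (p := Submodule.torsionBy R T (a ^ k)) z = _
      rw [← Submodule.Quotient.mk_smul, Submodule.Quotient.eq, Submodule.mem_torsionBy_iff, smul_sub,
        ← mul_smul, ← pow_succ, sub_eq_zero]
      exact hz
    exact fun i => FE.of_finite
  · exact ⟨htor, hp, hf⟩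

lemma cf_one_dim {I b : Ideal R} (hI : I ≤ b) 
    (hb : ∀ q : Ideal R, q.IsPrime → b ≤ q → q.IsMaximal ∨ q ∈ b.minimalPrimes)
    (T : Type u) [AddCommGroup T] [Module R T] (htor : Tor b T)
    (hf : FE I 0 T) (hf1 : FE I 1 T) : CF I T := by
  apply core (I := I) (fun T _ _ => Tor b T ∧ FE I 0 T ∧ FE I 1 T)
  · intro T _ _ h; exact h.2.1
  · intro T _ _ h x
    refine ⟨h.1.of_inj (Submodule.subtype _) (Submodule.subtype_injective _), 
      h.2.1.of_inj_zero (Submodule.subtype_injective _), ?_⟩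
    have s : SES (Submodule.torsionBy R T x).subtype (LinearMap.lsmul R T x).rangeRestrict := by
      refine ⟨Submodule.subtype_injective _, LinearMap.surjective_rangeRestrict _, ?_⟩
      rw [LinearMap.exact_iff, Submodule.range_subtype, LinearMap.ker_rangeRestrict]
      rfl
    exact s.fe1 (h.2.1.of_inj_zero (Submodule.subtype_injective _)) h.2.2
  · intro T _ _ h a ha
    have hfin : b.minimalPrimes.Finite := Ideal.finite_minimalPrimes_of_isNoetherianRing R b
    have h1 : ∀ p ∈ b.minimalPrimes, ∃ k, ∀ t : T, ∃ s ∉ p, ∃ t' : T, s • a ^ k • t = a ^ (k+1) • t' :=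
      fun p hp => generic_stab I b p hI hp h.1 ((finite_ext_zero_iff I).1 h.2.1) a
    choose! g hg using h1
    let k := hfin.toFinset.sup g
    have hk : ∀ p ∈ b.minimalPrimes, ∀ t : T, ∃ s ∉ p, ∃ t' : T, s • a ^ k • t = a ^ (k+1) • t' := by
      intro p hp t
      obtain ⟨s, hs, t', e⟩ := hg p hp t
      have hle : g p ≤ k := Finset.le_sup (f := g) (by simpa using hp)
      refine ⟨s, hs, t', ?_⟩
      obtain ⟨d, hd⟩ := Nat.exists_eq_add_of_le hle
      rw [hd, pow_add, mul_comm, mul_smul, smul_comm, e, ← mul_smul, ← pow_add]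
      congr 2
      lia
    refine ⟨k, fun hT0 hU => ?_⟩
    have hker := ker_cf a k hT0 hU
    have s0 := SES.submodule (Submodule.torsionBy R T (a ^ k))
    have f0 : FE I 0 (T ⧸ Submodule.torsionBy R T (a ^ k)) := s0.fe3 h.2.1 (hT0 _)
    have f1 : FE I 1 (T ⧸ Submodule.torsionBy R T (a ^ k)) := s0.fe3 h.2.2 (hT0 _)
    set T2 := T ⧸ Submodule.torsionBy R T (a ^ k) with hT2
    have s1 : SES (LinearMap.lsmul R T2 a).ker.subtype (LinearMap.lsmul R T2 a).rangeRestrict := by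
      refine ⟨Submodule.subtype_injective _, LinearMap.surjective_rangeRestrict _, ?_⟩
      rw [LinearMap.exact_iff, Submodule.range_subtype, LinearMap.ker_rangeRestrict]
    have f2 : FE I 1 (LinearMap.lsmul R T2 a).range := s1.fe3 f1 (hker _)
    have f3 : FE I 0 (T2 ⧸ (LinearMap.lsmul R T2 a).range) := (SES.submodule _).fe3 f0 f2
    have htor2 : Tor b (T2 ⧸ (LinearMap.lsmul R T2 a).range) := 
      (h.1.of_surj (Submodule.mkQ _) (Submodule.mkQ_surjective _)).of_surj (Submodule.mkQ _) (Submodule.mkQ_surjective _)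
    apply cf_zero_dim _ (htor2.mono hI) _ f3
    intro w q hq hle
    have hbq : b ≤ q := by
      obtain ⟨n, hn⟩ := htor2 w
      exact hq.le_of_pow_le (n := n) (fun x hx => hle ((Ideal.mem_torsionOf_iff _ _).2 (hn x hx)))
    refine (hb q hq hbq).resolve_right fun hmin => ?_
    obtain ⟨w, rfl⟩ := Submodule.Quotient.mk_surjective _ w
    obtain ⟨t, rfl⟩ := Submodule.Quotient.mk_surjective _ w
    obtain ⟨s, hs, t', e⟩ := hk q hmin t
    apply hs
    apply hle
    rw [Ideal.mem_torsionOf_iff, ← Submodule.Quotient.mk_smul, Submodule.Quotient.mk_eq_zero]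
    refine ⟨Submodule.Quotient.mk t', ?_⟩
    change a • Submodule.Quotient.mk (p := Submodule.torsionBy R T (a ^ k)) t' = _
    rw [← Submodule.Quotient.mk_smul, ← Submodule.Quotient.mk_smul, Submodule.Quotient.eq, Submodule.mem_torsionBy_iff, smul_sub,
      ← mul_smul, ← pow_succ, sub_eq_zero, ← e, smul_comm]
  · exact ⟨htor, hf, hf1⟩
end crit


section gam
open Abelian (Ext)
variable (I : Ideal R) {A B C : Type u} [AddCommGroup A] [Module R A] [AddCommGroup B] [Module R B]
  [AddCommGroup C] [Module R C]

/-- power torsion submodule -/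
def Gam (N : Type u) [AddCommGroup N] [Module R N] : Submodule R N where
  carrier := {x | ∃ n : ℕ, ∀ a ∈ I ^ n, a • x = 0}
  zero_mem' := ⟨0, by simp⟩
  add_mem' := by
    rintro x y ⟨n, hn⟩ ⟨m, hm⟩
    exact ⟨max n m, fun a ha => by
      rw [smul_add, hn a (Ideal.pow_le_pow_right (le_max_left _ _) ha), 
        hm a (Ideal.pow_le_pow_right (le_max_right _ _) ha), add_zero]⟩
  smul_mem' := by
    rintro r x ⟨n, hn⟩
    exact ⟨n, fun a ha => by rw [smul_comm, hn a ha, smul_zero]⟩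

lemma mem_Gam {N : Type u} [AddCommGroup N] [Module R N] (x : N) : 
    x ∈ Gam I N ↔ ∃ n : ℕ, ∀ a ∈ I ^ n, a • x = 0 := Iff.rfl

lemma tor_Gam (N : Type u) [AddCommGroup N] [Module R N] : Tor I (Gam I N) := by
  rintro ⟨x, n, hn⟩
  exact ⟨n, fun a ha => Subtype.ext (hn a ha)⟩

lemma unif_tor (hT : Tor I A) [Module.Finite R B] (g : B →ₗ[R] A) : ∃ n, ∀ a ∈ I ^ n, ∀ x, a • g x = 0 := by
  obtain ⟨s, hs⟩ := Module.Finite.fg_top (R := R) (M := B)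
  choose f hf using hT
  refine ⟨s.sup (fun x => f (g x)), fun a ha x => ?_⟩
  have hx : x ∈ Submodule.span R (s : Set B) := by rw [hs]; trivial
  induction hx using Submodule.span_induction with
  | mem x hx => exact hf _ a (Ideal.pow_le_pow_right (Finset.le_sup (f := fun x => f (g x)) hx) ha)
  | zero => simp
  | add x y _ _ hx hy => rw [map_add, smul_add, hx, hy, add_zero]
  | smul c x _ hx => rw [map_smul, smul_comm, hx, smul_zero]

lemma Gam_tf [IsNoetherianRing R] {N : Type u} [AddCommGroup N] [Module R N] (n : ℕ) (x : N ⧸ Gam I N) 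
    (hx : ∀ a ∈ I ^ n, a • x = 0) : x = 0 := by
  obtain ⟨x, rfl⟩ := Submodule.Quotient.mk_surjective _ x
  rw [Submodule.Quotient.mk_eq_zero]
  have hx' : ∀ a ∈ I ^ n, a • x ∈ Gam I N := fun a ha => by
    rw [← Submodule.Quotient.mk_eq_zero, Submodule.Quotient.mk_smul, hx a ha]
  let g : ↥(I ^ n) →ₗ[R] Gam I N := LinearMap.codRestrict _ 
    ((LinearMap.toSpanSingleton R N x) ∘ₗ (Submodule.subtype (I ^ n))) (fun a => hx' a.1 a.2)
  obtain ⟨m, hm⟩ := unif_tor I (tor_Gam I N) g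
  refine ⟨m + n, ?_⟩
  have : I ^ (m + n) ≤ Ideal.torsionOf R N x := by
    rw [pow_add, Ideal.mul_le]
    intro r hr s hs
    rw [Ideal.mem_torsionOf_iff, mul_smul]
    exact congrArg (fun z => z.1) (hm r hr ⟨s, hs⟩)
  exact fun a ha => (Ideal.mem_torsionOf_iff _ _).1 (this ha)

lemma ext_tf_zero [IsNoetherianRing R] {N : Type u} [AddCommGroup N] [Module R N] (n : ℕ) (X : ModuleCat.{u} R)
    (hX : ∀ x : X, ∀ a ∈ I ^ n, a • x = 0) (z : Ext X (ModuleCat.of R (N ⧸ Gam I N)) 0) : z = 0 := by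
  obtain ⟨f, rfl⟩ := Ext.linearEquiv₀ (R := R) |>.symm.surjective z
  have : f = 0 := by
    apply ModuleCat.hom_ext
    ext x
    exact Gam_tf I n _ (fun a ha => by rw [← map_smul, hX x a ha, map_zero])
  rw [this, map_zero]

lemma Gam_injective [IsNoetherianRing R] {E : Type u} [AddCommGroup E] [Module R E] (hE : Module.Injective R E) :
    Module.Injective R (Gam I E) := by
  apply Module.Baer.injective
  intro J g
  obtain ⟨n, hn⟩ := unif_tor I (tor_Gam I E) g
  obtain ⟨k, hk⟩ := Ideal.exists_pow_inf_eq_pow_smul I (M := R) J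
  have hk' := hk (n + k) (Nat.le_add_left _ _)
  simp only [Nat.add_sub_cancel] at hk'
  let φ : J →ₗ[R] (R ⧸ I ^ (n + k)) := (Submodule.mkQ _) ∘ₗ (Submodule.subtype J)
  have hker : φ.ker ≤ ((Gam I E).subtype ∘ₗ g).ker := by
    intro x hx
    have hx1 : x.1 ∈ I ^ (n + k) := by
      have h3 : Submodule.Quotient.mk (p := I ^ (n+k)) x.1 = 0 := hx
      rwa [Submodule.Quotient.mk_eq_zero] at h3
    have hx2 : x.1 ∈ I ^ n • J := by
      have h1 : x.1 ∈ (I ^ (n + k) • ⊤ ⊓ J : Submodule R R) := by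
        refine ⟨?_, x.2⟩
        simpa using hx1
      rw [hk'] at h1
      exact Submodule.smul_mono le_rfl inf_le_right h1
    have h3 : x ∈ I ^ n • (⊤ : Submodule R J) := by
      rw [Submodule.mem_smul_top_iff]
      exact hx2
    have h4 : g x = 0 := by
      refine Submodule.smul_induction_on (p := fun x => g x = 0) h3 ?_ ?_
      · intro r hr y _
        rw [map_smul]; exact hn r hr y
      · intro x y hx hy
        rw [map_add, hx, hy, add_zero]
    rw [LinearMap.mem_ker, LinearMap.comp_apply, h4, map_zero]
  let ψ : (J ⧸ φ.ker) →ₗ[R] E := Submodule.liftQ _ _ hker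
  obtain ⟨h, hh⟩ := hE.out (φ.ker.liftQ φ le_rfl) (by
    rw [← LinearMap.ker_eq_bot]; exact Submodule.ker_liftQ_eq_bot _ _ _ le_rfl) ψ
  have hmem : h (Submodule.Quotient.mk 1) ∈ Gam I E := by
    refine ⟨n + k, fun a ha => ?_⟩
    rw [← map_smul, ← Submodule.Quotient.mk_smul, (Submodule.Quotient.mk_eq_zero _).2 (by simpa using ha), map_zero]
  refine ⟨LinearMap.toSpanSingleton R _ ⟨_, hmem⟩, fun x hx => ?_⟩
  apply Subtype.ext
  change x • h (Submodule.Quotient.mk 1) = _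
  rw [← map_smul, ← Submodule.Quotient.mk_smul, smul_eq_mul, mul_one]
  exact hh (Submodule.Quotient.mk ⟨x, hx⟩)

lemma ext_inj_zero {E : Type u} [AddCommGroup E] [Module R E] (hE : Module.Injective R E) (X : ModuleCat.{u} R)
    (i : ℕ) (x : Ext X (ModuleCat.of R E) (i+1)) : x = 0 := by
  have := Module.injective_object_of_injective_module R E
  exact Ext.eq_zero_of_injective x

lemma exists_embed (N : Type u) [AddCommGroup N] [Module R N] : ∃ (E : Type u) (_ : AddCommGroup E) (_ : Module R E),
    Module.Injective R E ∧ ∃ f : N →ₗ[R] E, Function.Injective f := by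
  let N' : ModuleCat.{u} R := ModuleCat.of R N
  let U : ModuleCat.{u} R := Injective.under N'
  refine ⟨U, inferInstance, inferInstance, ?_, (Injective.ι N').hom, ?_⟩
  · have : CategoryTheory.Injective (ModuleCat.of R U) :=
      inferInstanceAs (CategoryTheory.Injective (Injective.under N'))
    exact Module.injective_module_of_injective_object R _
  · exact (ModuleCat.mono_iff_injective _).1 inferInstance

lemma ext_quot_zero [IsNoetherianRing R] {E : Type u} [AddCommGroup E] [Module R E] (hE : Module.Injective R E)
    (n : ℕ) (X : ModuleCat.{u} R)
    (hX : ∀ x : X, ∀ a ∈ I ^ n, a • x = 0) (i : ℕ) (z : Ext X (ModuleCat.of R (E ⧸ Gam I E)) i) : z = 0 := by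
  cases i with
  | zero => exact ext_tf_zero I n X hX z
  | succ i =>
    obtain ⟨y, rfl⟩ := ((SES.submodule (Gam I E)).ex3 X (i+1) z).1 (ext_inj_zero (Gam_injective I hE) _ _ _)
    rw [ext_inj_zero hE _ _ y, map_zero]

/-- evaluation at one -/
noncomputable def ev (J : Ideal R) (A : Type u) [AddCommGroup A] [Module R A] : 
    Ext (ModuleCat.of R (R ⧸ J)) (ModuleCat.of R A) 0 →ₗ[R] A :=
  (LinearMap.applyₗ (1 : R ⧸ J)) ∘ₗ ModuleCat.homLinearEquiv.toLinearMap ∘ₗ (Ext.linearEquiv₀ (R := R)).toLinearMap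

lemma ev_mk₀ (J : Ideal R) (f : ModuleCat.of R (R ⧸ J) ⟶ ModuleCat.of R A) : ev J A (Ext.mk₀ f) = f.hom (1 : R ⧸ J) := by
  have : Ext.linearEquiv₀ (R := R) (Ext.mk₀ f) = f := (Ext.linearEquiv₀ (R := R)).apply_symm_apply f
  change (Ext.linearEquiv₀ (R := R) (Ext.mk₀ f)).hom (1 : R ⧸ J) = _
  rw [this]

lemma ext0_surj (X Y : ModuleCat.{u} R) (x : Ext X Y 0) : ∃ f : X ⟶ Y, Ext.mk₀ f = x :=
  ⟨Ext.linearEquiv₀ (R := R) x, Ext.mk₀_linearEquiv₀_apply x⟩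

lemma ev_inj (J : Ideal R) : Function.Injective (ev J A) := by
  intro x y h
  obtain ⟨f, rfl⟩ := ext0_surj _ _ x
  obtain ⟨g, rfl⟩ := ext0_surj _ _ y
  rw [ev_mk₀, ev_mk₀] at h
  congr 1
  apply ModuleCat.hom_ext
  apply Submodule.linearMap_qext
  ext
  exact h

lemma ev_po (J : Ideal R) (f : A →ₗ[R] B) (x) : ev J B (po f _ 0 x) = f (ev J A x) := by
  obtain ⟨g, rfl⟩ := ext0_surj _ _ x
  rw [po_apply, Ext.mk₀_comp_mk₀, ev_mk₀, ev_mk₀]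
  rfl

lemma ev_rs {m n : ℕ} (h : m ≤ n) (x) : ev (I ^ n) A (rs I h _ 0 x) = ev (I ^ m) A x := by
  obtain ⟨g, rfl⟩ := ext0_surj _ _ x
  rw [rs_apply, Ext.mk₀_comp_mk₀]
  rw [ev_mk₀ (I ^ n) (tr I h ≫ g), ev_mk₀ (I ^ m) g]
  rfl

variable [IsNoetherianRing R]

lemma ev_tor (J : Ideal R) (x) (j : R) (hj : j ∈ J) : j • ev J A x = 0 := by
  rw [← map_smul, smul_ext_quot hj, map_zero]

lemma ev_surj (J : Ideal R) (a : A) (h : ∀ j ∈ J, j • a = 0) : ∃ x, ev J A x = a := by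
  refine ⟨Ext.mk₀ (ModuleCat.ofHom (Submodule.liftQ J (LinearMap.toSpanSingleton R A a) (fun j hj => h j hj))), ?_⟩
  rw [ev_mk₀]
  change (1 : R) • a = a
  simp

lemma isLC_zero (N : Type u) [AddCommGroup N] [Module R N] : ∃ ι, IsLC I 0 (ModuleCat.of R N) (Gam I N) ι := by
  refine ⟨fun n => LinearMap.codRestrict _ (ev (I ^ n) N) (fun x => ⟨n, fun a ha => ev_tor _ x a ha⟩), ?_, ?_, ?_⟩
  · intro m n h x
    exact Subtype.ext (ev_rs I h x)
  · rintro ⟨y, n, hn⟩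
    obtain ⟨x, hx⟩ := ev_surj (I ^ n) y hn
    exact ⟨n, x, Subtype.ext hx⟩
  · intro n x hx
    refine ⟨n, le_rfl, ?_⟩
    have : x = 0 := ev_inj _ ((congrArg (fun z => z.1) hx).trans (map_zero _).symm)
    rw [this, map_zero]

lemma acyclic (i : ℕ) : ∀ {T : Type u} [AddCommGroup T] [Module R T] (_ : Tor I T) (n : ℕ) 
    (x : Ext (Qn I n) (ModuleCat.of R T) (i+1)), ∃ m, ∃ h : n ≤ m, rs I h _ _ x = 0 := by
  induction i with
  | zero =>
    intro T _ _ hT n x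
    obtain ⟨E, _, _, hE, f, hf⟩ := exists_embed (R := R) T
    let f' : T →ₗ[R] Gam I E := LinearMap.codRestrict _ f (fun t => by
      obtain ⟨n, hn⟩ := hT t
      exact ⟨n, fun a ha => by rw [← map_smul, hn a ha, map_zero]⟩)
    have hf' : Function.Injective f' := fun x y h => hf (congrArg (fun z => z.1) h)
    have s := SES.of_injective hf'
    obtain ⟨y, rfl⟩ := (s.ex1 _ _ x).1 (ext_inj_zero (Gam_injective I hE) _ _ _)
    obtain ⟨e, he⟩ := Submodule.mkQ_surjective _ (ev (I ^ n) _ y)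
    obtain ⟨m, hm⟩ := tor_Gam I E e
    obtain ⟨z, hz⟩ := ev_surj (I ^ (max n m)) e (fun j hj => hm j (Ideal.pow_le_pow_right (le_max_right _ _) hj))
    refine ⟨max n m, le_max_left _ _, ?_⟩
    rw [s.rs_del]
    apply (s.ex3 _ _ _).2
    refine ⟨z, ev_inj _ ?_⟩
    rw [ev_po, ev_rs, hz, he]
  | succ i ih =>
    intro T _ _ hT n x
    obtain ⟨E, _, _, hE, f, hf⟩ := exists_embed (R := R) T
    let f' : T →ₗ[R] Gam I E := LinearMap.codRestrict _ f (fun t => by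
      obtain ⟨n, hn⟩ := hT t
      exact ⟨n, fun a ha => by rw [← map_smul, hn a ha, map_zero]⟩)
    have hf' : Function.Injective f' := fun x y h => hf (congrArg (fun z => z.1) h)
    have s := SES.of_injective hf'
    obtain ⟨y, rfl⟩ := (s.ex1 _ _ x).1 (ext_inj_zero (Gam_injective I hE) _ _ _)
    obtain ⟨m, h, hm⟩ := ih ((tor_Gam I E).of_surj (Submodule.mkQ _) (Submodule.mkQ_surjective f'.range)) n y
    refine ⟨m, h, ?_⟩
    rw [s.rs_del, hm, map_zero]
end gam


section final
open Abelian (Ext)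
variable [IsNoetherianRing R] (I : Ideal R)

lemma kill_Qn (n : ℕ) (x : Qn I n) (a : R) (ha : a ∈ I ^ n) : a • x = 0 := by
  obtain ⟨y, rfl⟩ := Submodule.Quotient.mk_surjective (I ^ n) x
  rw [← Submodule.Quotient.mk_smul, Submodule.Quotient.mk_eq_zero]
  exact Ideal.mul_mem_right _ _ ha

lemma kill_Q (x : ModuleCat.of R (R ⧸ I)) (a : R) (ha : a ∈ I ^ 1) : a • x = 0 := by
  rw [pow_one] at ha
  obtain ⟨y, rfl⟩ := Submodule.Quotient.mk_surjective I x
  rw [← Submodule.Quotient.mk_smul, Submodule.Quotient.mk_eq_zero]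
  exact Ideal.mul_mem_right _ _ ha

lemma shift_aux (N : Type u) [AddCommGroup N] [Module R N] :
    ∃ (N1 : Type u) (_ : AddCommGroup N1) (_ : Module R N1) (E : Type u) (_ : AddCommGroup E)
      (_ : Module R E) (f : (N ⧸ Gam I N) →ₗ[R] E) (g : E →ₗ[R] N1) (s : SES f g),
      ∀ (n : ℕ) (X : ModuleCat.{u} R), (∀ x : X, ∀ a ∈ I ^ n, a • x = 0) → ∀ i,
        Function.Bijective (s.del X i) := by
  obtain ⟨E, _, _, hE, f, hf⟩ := exists_embed (R := R) (N ⧸ Gam I N)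
  let f' : (N ⧸ Gam I N) →ₗ[R] (E ⧸ Gam I E) := (Gam I E).mkQ ∘ₗ f
  have hf' : Function.Injective f' := by
    rw [injective_iff_map_eq_zero]
    intro x hx
    have hx' : f x ∈ Gam I E := (Submodule.Quotient.mk_eq_zero _).1 hx
    obtain ⟨n, hn⟩ := hx'
    refine Gam_tf I n x (fun a ha => hf ?_)
    rw [map_smul, hn a ha, map_zero]
  have s := SES.of_injective hf'
  refine ⟨_, _, _, _, _, _, f', _, s, fun n X hX i => ⟨?_, ?_⟩⟩
  · rw [injective_iff_map_eq_zero]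
    intro x hx
    obtain ⟨y, rfl⟩ := (s.ex3 X i x).1 hx
    rw [ext_quot_zero I hE n X hX i y, map_zero]
  · intro x
    exact (s.ex1 X i x).1 (ext_quot_zero I hE n X hX _ _)

lemma lc_mod_gam (N : Type u) [AddCommGroup N] [Module R N] (i : ℕ) (L : Type u) [AddCommGroup L] [Module R L]
    (ι) (h : IsLC I (i+1) (ModuleCat.of R (N ⧸ Gam I N)) L ι) :
    IsLC I (i+1) (ModuleCat.of R N) L (fun n => ι n ∘ₗ po (Gam I N).mkQ (Qn I n) (i+1)) := by
  have s := SES.submodule (Gam I N)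
  refine ⟨?_, ?_, ?_⟩
  · intro m n hmn x
    simp only [LinearMap.comp_apply]
    rw [← rs_po, h.compat]
  · intro y
    obtain ⟨n, x, rfl⟩ := h.surj y
    obtain ⟨m, hnm, hm⟩ := acyclic I (i+1) (tor_Gam I N) n (s.del _ _ x)
    rw [s.rs_del] at hm
    obtain ⟨z, hz⟩ := (s.ex3 _ _ _).1 hm
    refine ⟨m, z, ?_⟩
    simp only [LinearMap.comp_apply]
    rw [hz, h.compat]
  · intro n x hx
    obtain ⟨m, hnm, hm⟩ := h.inj n _ hx
    rw [rs_po] at hm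
    obtain ⟨z, hz⟩ := (s.ex2 _ _ _).1 hm
    obtain ⟨k, hmk, hk⟩ := acyclic I i (tor_Gam I N) m z
    refine ⟨k, hnm.trans hmk, ?_⟩
    rw [← rs_rs I hnm hmk, ← hz, rs_po, hk, map_zero]

lemma lc_shift {A B C : Type u} [AddCommGroup A] [Module R A] [AddCommGroup B] [Module R B]
    [AddCommGroup C] [Module R C] {f : A →ₗ[R] B} {g : B →ₗ[R] C} (s : SES f g) (i : ℕ)
    (hs : ∀ n, Function.Bijective (s.del (Qn I n) i)) (L : Type u) [AddCommGroup L] [Module R L]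
    (ι) (h : IsLC I i (ModuleCat.of R C) L ι) : ∃ ι', IsLC I (i+1) (ModuleCat.of R A) L ι' := by
  refine ⟨fun n => ι n ∘ₗ (LinearEquiv.ofBijective _ (hs n)).symm.toLinearMap, ?_⟩
  have key : ∀ n x, (ι n ∘ₗ (LinearEquiv.ofBijective _ (hs n)).symm.toLinearMap) (s.del (Qn I n) i x) = ι n x := by
    intro n x
    exact congrArg (ι n) ((LinearEquiv.ofBijective _ (hs n)).symm_apply_apply x)
  refine ⟨?_, ?_, ?_⟩
  · intro m n hmn x
    obtain ⟨x, rfl⟩ := (hs m).2 x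
    rw [s.rs_del, key, key, h.compat]
  · intro y
    obtain ⟨n, x, rfl⟩ := h.surj y
    exact ⟨n, _, key n x⟩
  · intro n x hx
    obtain ⟨x, rfl⟩ := (hs n).2 x
    rw [key] at hx
    obtain ⟨m, hnm, hm⟩ := h.inj n _ hx
    refine ⟨m, hnm, ?_⟩
    rw [s.rs_del, hm, map_zero]

lemma cf_gam {b : Ideal R} (hI : I ≤ b)
    (hb : ∀ q : Ideal R, q.IsPrime → b ≤ q → q.IsMaximal ∨ q ∈ b.minimalPrimes)
    (N : Type u) [AddCommGroup N] [Module R N] (hN : CF I N) (hT : Tor b (Gam I N)) : CF I (Gam I N) := by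
  have s := SES.submodule (Gam I N)
  have h0 : FE I 0 (N ⧸ Gam I N) := by
    have : Subsingleton (Ext (ModuleCat.of R (R ⧸ I)) (ModuleCat.of R (N ⧸ Gam I N)) 0) :=
      subsingleton_of_forall_eq 0 (fun z => ext_tf_zero I 1 _ (kill_Q I) z)
    unfold FE
    infer_instance
  exact cf_one_dim hI hb _ hT ((hN 0).of_inj_zero s.inj) (s.fe1 h0 (hN 1))

lemma main_ind {b : Ideal R} (hI : I ≤ b)
    (hb : ∀ q : Ideal R, q.IsPrime → b ≤ q → q.IsMaximal ∨ q ∈ b.minimalPrimes) (i : ℕ) :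
    ∀ (N : Type u) [AddCommGroup N] [Module R N] (_ : CF I N)
      (_ : ∀ (j : ℕ) (L : Type u) [AddCommGroup L] [Module R L] (ι), IsLC I j (ModuleCat.of R N) L ι → Tor b L)
      (L : Type u) [AddCommGroup L] [Module R L] (ι), IsLC I i (ModuleCat.of R N) L ι → CF I L := by
  induction i with
  | zero =>
    intro N _ _ hN hT L _ _ ι h
    obtain ⟨ι', h'⟩ := isLC_zero I N
    obtain ⟨e⟩ := h'.nonempty_equiv I h
    exact (cf_gam I hI hb N hN (hT 0 _ _ h')).of_equiv e
  | succ i ih =>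
    intro N _ _ hN hT L _ _ ι h
    obtain ⟨ι', h'⟩ := isLC_zero I N
    have hG := cf_gam I hI hb N hN (hT 0 _ _ h')
    have hN' := (SES.submodule (Gam I N)).cf3 hG hN
    obtain ⟨N1, _, _, E, _, _, f, g, s, hs⟩ := shift_aux I N
    have hN1 : CF I N1 := by
      intro j
      have h1 : Module.Finite R (Ext (ModuleCat.of R (R ⧸ I)) (ModuleCat.of R (N ⧸ Gam I N)) (j+1)) := hN' (j+1)
      exact Module.Finite.equiv (LinearEquiv.ofBijective _ (hs 1 _ (kill_Q I) j)).symm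
    have sh : ∀ (j : ℕ) (L : Type u) [AddCommGroup L] [Module R L] (ι), IsLC I j (ModuleCat.of R N1) L ι →
        ∃ ι', IsLC I (j+1) (ModuleCat.of R N) L ι' := by
      intro j L _ _ ι h
      obtain ⟨ι1, h1⟩ := lc_shift I s j (fun n => hs n _ (kill_Qn I n) j) L ι h
      exact ⟨_, lc_mod_gam I N j L ι1 h1⟩
    obtain ⟨ι1, h1⟩ := exists_isLC I i (ModuleCat.of R N1)
    have hc := ih N1 hN1 (fun j L _ _ ι h => by
      obtain ⟨ι2, h2⟩ := sh j L ι h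
      exact hT _ _ _ h2) _ ι1 h1
    obtain ⟨ι2, h2⟩ := sh _ _ _ h1
    obtain ⟨e⟩ := h2.nonempty_equiv I h
    exact hc.of_equiv e

lemma lc_tor (N : Type u) [AddCommGroup N] [Module R N] (j : ℕ) (L : Type u) [AddCommGroup L] [Module R L]
    (ι) (h : IsLC I j (ModuleCat.of R N) L ι) : Tor (Module.annihilator R N ⊔ I) L := by
  intro y
  obtain ⟨n, x, rfl⟩ := h.surj y
  refine ⟨1 + n, fun a ha => ?_⟩
  have ha' := Ideal.sup_pow_add_le_pow_sup_pow ha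
  rw [pow_one] at ha'
  obtain ⟨c, hc, d, hd, rfl⟩ := Submodule.mem_sup.1 ha'
  rw [← map_smul, add_smul, smul_ext_quot hd, 
    smul_eq_zero_ext' c _ (fun z => (Module.mem_annihilator.1 hc) z), add_zero, map_zero]

lemma dim_hyp (M : Type u) [AddCommGroup M] [Module R M] [Module.Finite R M]
    (hdim : Order.krullDim (Module.support R (M ⧸ (I • (⊤ : Submodule R M)))) ≤ 1) 
    (q : Ideal R) (hq : q.IsPrime) (hbq : Module.annihilator R M ⊔ I ≤ q) : 
    q.IsMaximal ∨ q ∈ (Module.annihilator R M ⊔ I).minimalPrimes := by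
  by_contra hcon
  push Not at hcon
  obtain ⟨h1, h2⟩ := hcon
  have hmem : ∀ p : PrimeSpectrum R, Module.annihilator R M ⊔ I ≤ p.asIdeal → 
      p ∈ Module.support R (M ⧸ (I • (⊤ : Submodule R M))) := by
    intro p hp
    rw [Module.support_quotient, Module.support_eq_zeroLocus]
    exact ⟨le_sup_left.trans hp, le_sup_right.trans hp⟩
  obtain ⟨m, hm, hqm⟩ := Ideal.exists_le_maximal q hq.ne_top
  obtain ⟨p, hp, hpq⟩ := Ideal.exists_minimalPrimes_le hbq
  have hlt1 : p < q := lt_of_le_of_ne hpq (fun e => h2 (e ▸ hp))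
  have hlt2 : q < m := lt_of_le_of_ne hqm (fun e => h1 (e ▸ hm))
  have hpp : p.IsPrime := hp.1.1
  let P : Module.support R (M ⧸ (I • (⊤ : Submodule R M))) := ⟨⟨p, hpp⟩, hmem _ hp.1.2⟩
  let Q : Module.support R (M ⧸ (I • (⊤ : Submodule R M))) := ⟨⟨q, hq⟩, hmem _ hbq⟩
  let W : Module.support R (M ⧸ (I • (⊤ : Submodule R M))) := ⟨⟨m, hm.isPrime⟩, hmem _ (hbq.trans hqm)⟩
  have e1 : P < Q := hlt1
  have e2 : Q < W := hlt2
  let S : LTSeries (Module.support R (M ⧸ (I • (⊤ : Submodule R M)))) :=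
    { length := 2
      toFun := ![P, Q, W]
      step := fun i => by
        fin_cases i
        · exact e1
        · exact e2 }
  have := (Order.LTSeries.length_le_krullDim S).trans hdim
  have h3 : S.length = 2 := rfl
  rw [h3] at this
  exact absurd this (by decide)

lemma cf_final (M : Type u) [AddCommGroup M] [Module R M] [Module.Finite R M]
    (hdim : Order.krullDim (Module.support R (M ⧸ (I • (⊤ : Submodule R M)))) ≤ 1) (i : ℕ) :
    CF I ((localCohomology I i).obj (ModuleCat.of R M)) := by
  obtain ⟨ι, h⟩ := exists_isLC I i (ModuleCat.of R M)
  exact main_ind I (b := Module.annihilator R M ⊔ I) le_sup_right 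
    (fun q hq hb => dim_hyp I M hdim q hq hb) i M
    (fun _ => FE.of_finite) (fun j L _ _ ι h => lc_tor I M j L ι h) _ ι h

lemma supp_final (M : Type u) [AddCommGroup M] [Module R M] (i : ℕ) :
    Module.support R ((localCohomology I i).obj (ModuleCat.of R M)) ⊆ PrimeSpectrum.zeroLocus (I : Set R) := by
  obtain ⟨ι, h⟩ := exists_isLC I i (ModuleCat.of R M)
  intro p hp
  obtain ⟨y, hy⟩ := Module.mem_support_iff'.1 hp
  obtain ⟨n, x, rfl⟩ := h.surj y
  intro a ha
  by_contra hap
  refine hy (a ^ n) (fun h' => hap (p.2.mem_of_pow_mem n h')) ?_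
  rw [← map_smul, smul_ext_quot (Ideal.pow_mem_pow ha n), map_zero]

end final

end LCCof

/-- Let `R` be a Noetherian ring and `I` an ideal of `R`.  If `M` is a
finitely generated `R`-module with `dim M/IM ≤ 1` (the Krull dimension of the support of
`M/IM`), then the `R`-modules `H^i_I(M)` are `I`-cofinite for all `i ≥ 0`. -/
theorem isCofinite_of_dim_quotient_le_one {R : Type u} [CommRing R] [IsNoetherianRing R]
    (I : Ideal R) (M : ModuleCat.{u} R) (hfg : Module.Finite R M)
    (hdim : Order.krullDim
      (Module.support R (M ⧸ (I • (⊤ : Submodule R M)))) ≤ 1) :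
    ∀ i : ℕ, IsCofinite I ((localCohomology I i).obj M) := by
  intro i
  refine ⟨LCCof.supp_final I M i, fun j => ?_⟩
  have h : Module.Finite R (Abelian.Ext (ModuleCat.of R (R ⧸ I)) ((localCohomology I i).obj M) j) :=
    LCCof.cf_final I M hdim i j
  exact Module.Finite.equiv (LCCof.extCmp (ModuleCat.of R (R ⧸ I)) ((localCohomology I i).obj M) j).symm
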